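/- Let λ/μ be a skew shape such that G_{λ/μ} is connected. The following conditions are equivalent: (1) I_{λ/μ} is Buchsbaum; (2) I_{λ/μ} is generalized Cohen-Macaulay; (3) either I_{λ/μ} is Cohen-Macaulay, or λ = (n, …, n) (n repeated n times) and μ = (0, …, 0). -/

import Mathlib

open CategoryTheory CategoryTheory.Limits MvPolynomial

noncomputable section

namespace SkewTab

/-! ### Partitions and skew shapes (0-indexed) -/

/-- `lam` is a partition with exactly `n` positive parts (0-indexed),
extended by `0` beyond index `n - 1`. -/
def IsPartitionFn (n : ℕ) (lam : ℕ → ℕ) : Prop :=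
  0 < n ∧ Antitone lam ∧ (∀ i, i < n → 0 < lam i) ∧ ∀ i, n ≤ i → lam i = 0

/-- `λ/μ` is a skew shape with `n` rows (0-indexed): `λ_i > μ_i ≥ 0` and `μ_n = 0`. -/
def IsSkewShape (n : ℕ) (lam mu : ℕ → ℕ) : Prop :=
  0 < n ∧ Antitone lam ∧ Antitone mu ∧ (∀ i, i < n → mu i < lam i) ∧
    (∀ i, n ≤ i → lam i = 0) ∧ mu (n - 1) = 0

/-- The conjugate partition: `conj lam j = #{i : lam i > j}` (0-indexed). -/
def conj (lam : ℕ → ℕ) (j : ℕ) : ℕ := Nat.card {i | j < lam i}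

/-- The set of boxes of the skew diagram `λ/μ` (0-indexed `(row, column)` pairs). -/
def skewDiagram (lam mu : ℕ → ℕ) : Set (ℕ × ℕ) :=
  {p | mu p.1 ≤ p.2 ∧ p.2 < lam p.1}

/-- The set of boxes of the Ferrers diagram of a partition. -/
def ferrers (nu : ℕ → ℕ) : Set (ℕ × ℕ) := {p | p.2 < nu p.1}

/-- The block of the Ferrers diagram of `nu` containing the box `p`:  blocks are the
rectangular regions cut out by the horizontal lines at the values of the conjugate
partition and the vertical lines at the values of the partition. -/
def blockOf (nu : ℕ → ℕ) (p : ℕ × ℕ) : Set (ℕ × ℕ) :=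
  {q | q.2 < nu q.1 ∧ nu q.1 = nu p.1 ∧ conj nu q.2 = conj nu p.2}

/-- A box `(i,j)` of the diagram of `nu` lies in a *corner block* iff its block has no
block to its right nor below it. -/
def InCornerBlock (nu : ℕ → ℕ) (i j : ℕ) : Prop :=
  j < nu i ∧ conj nu (nu i - 1) = conj nu j ∧ nu (conj nu j - 1) = nu i

/-- A partition is unmixed iff all its corner blocks are square
(height of the block = width of the block). -/
def IsUnmixedPartition (nu : ℕ → ℕ) : Prop :=
  (∃ n, IsPartitionFn n nu) ∧
    ∀ i j, InCornerBlock nu i j →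
      conj nu (nu i - 1) - conj nu (nu i) = nu (conj nu j - 1) - nu (conj nu j)

/-- A partition all of whose corner blocks are single boxes (1 × 1):
the condition defining prime Cohen-Macaulay shapes. -/
def IsCMPartition (nu : ℕ → ℕ) : Prop :=
  (∃ n, IsPartitionFn n nu) ∧
    ∀ i j, InCornerBlock nu i j →
      conj nu (nu i - 1) - conj nu (nu i) = 1 ∧ nu (conj nu j - 1) - nu (conj nu j) = 1

/-- A copy of (the diagram of) a partition `nu` placed in the plane.  If `upper = true`
it is placed rotated by 180° and anchored at the bottom-right position `(row, col)`
(an upper triangular shape, hugging the top-right); if `upper = false` it is placed as is,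
translated by `(row, col)` (a lower triangular shape, hugging the bottom-left). -/
structure PlacedShape where
  nu : ℕ → ℕ
  row : ℕ
  col : ℕ
  upper : Bool

/-- The embedding of the abstract diagram of `B.nu` into the plane. -/
def PlacedShape.emb (B : PlacedShape) : ℕ × ℕ → ℕ × ℕ := fun p =>
  if B.upper then (B.row - p.1, B.col - p.2) else (B.row + p.1, B.col + p.2)

/-- The set of boxes of a placed shape. -/
def PlacedShape.boxes (B : PlacedShape) : Set (ℕ × ℕ) := B.emb '' ferrers B.nu

/-- For an upper triangular placed shape the anchor must leave room for the whole
(rotated) diagram. -/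
def PlacedShape.Valid (B : PlacedShape) : Prop :=
  B.upper = true → conj B.nu 0 ≤ B.row + 1 ∧ B.nu 0 ≤ B.col + 1

/-- The two extremal blocks (top-right and bottom-left corner blocks) of a placed
shape, as subsets of the plane. -/
def PlacedShape.extremalBlocks (B : PlacedShape) : Set (Set (ℕ × ℕ)) :=
  {B.emb '' blockOf B.nu (0, B.nu 0 - 1), B.emb '' blockOf B.nu (conj B.nu 0 - 1, 0)}

/-- `D` decomposes as a union of prime shapes `B 0, …, B (t-1)` (each a placed copy of a
partition satisfying `P`), consecutive shapes being of alternating (upper/lower) type and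
intersecting exactly in a common extremal block. -/
def IsPrimeDecomposition (P : (ℕ → ℕ) → Prop) (D : Set (ℕ × ℕ)) (t : ℕ)
    (B : ℕ → PlacedShape) : Prop :=
  0 < t ∧ (∀ k, k < t → P (B k).nu ∧ (B k).Valid) ∧
    (⋃ k ∈ Set.Iio t, (B k).boxes) = D ∧
    (∀ k, k + 1 < t → (B k).upper ≠ (B (k + 1)).upper) ∧
    ∀ k, k + 1 < t →
      (B k).boxes ∩ (B (k + 1)).boxes ∈ (B k).extremalBlocks ∧
      (B k).boxes ∩ (B (k + 1)).boxes ∈ (B (k + 1)).extremalBlocks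

/-- The filling `w` is weakly increasing along both rows and columns on the boxes of `S`. -/
def WeaklyIncreasingOn (w : ℕ → ℕ → ℕ) (S : Set (ℕ × ℕ)) : Prop :=
  (∀ i j, (i, j) ∈ S → (i, j + 1) ∈ S → w i j ≤ w i (j + 1)) ∧
    ∀ i j, (i, j) ∈ S → (i + 1, j) ∈ S → w i j ≤ w (i + 1) j

/-- The filling `w` is weakly decreasing along both rows and columns on the boxes of `S`. -/
def WeaklyDecreasingOn (w : ℕ → ℕ → ℕ) (S : Set (ℕ × ℕ)) : Prop :=
  (∀ i j, (i, j) ∈ S → (i, j + 1) ∈ S → w i (j + 1) ≤ w i j) ∧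
    ∀ i j, (i, j) ∈ S → (i + 1, j) ∈ S → w (i + 1) j ≤ w i j

/-! ### Ideals and graphs attached to skew shapes -/

/-- The skew Ferrers ideal `I_{λ/μ}` in `k[x_1,…,x_n,y_1,…,y_m]`, `m = λ_1`. -/
def skewIdeal (k : Type) [Field k] (n : ℕ) (lam mu : ℕ → ℕ) :
    Ideal (MvPolynomial (Fin n ⊕ Fin (lam 0)) k) :=
  Ideal.span {q | ∃ (i : Fin n) (j : Fin (lam 0)),
    mu (i : ℕ) ≤ (j : ℕ) ∧ (j : ℕ) < lam (i : ℕ) ∧ q = X (Sum.inl i) * X (Sum.inr j)}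

/-- The skew tableau ideal `I(Y)` of the filling `w` of the skew shape `λ/μ`. -/
def tableauIdeal (k : Type) [Field k] (n : ℕ) (lam mu : ℕ → ℕ) (w : ℕ → ℕ → ℕ) :
    Ideal (MvPolynomial (Fin n ⊕ Fin (lam 0)) k) :=
  Ideal.span {q | ∃ (i : Fin n) (j : Fin (lam 0)),
    mu (i : ℕ) ≤ (j : ℕ) ∧ (j : ℕ) < lam (i : ℕ) ∧
      q = (X (Sum.inl i) * X (Sum.inr j)) ^ w (i : ℕ) (j : ℕ)}

/-- The skew tableau ideal of the skew tableau obtained from `Y` by keeping only the rows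
in `Rs` and the columns in `Cs`. -/
def tableauIdealRC (k : Type) [Field k] (n m : ℕ) (lam mu : ℕ → ℕ) (w : ℕ → ℕ → ℕ)
    (Rs : Set (Fin n)) (Cs : Set (Fin m)) : Ideal (MvPolynomial (↥Rs ⊕ ↥Cs) k) :=
  Ideal.span {q | ∃ (i : ↥Rs) (j : ↥Cs),
    mu (i.1 : ℕ) ≤ (j.1 : ℕ) ∧ (j.1 : ℕ) < lam (i.1 : ℕ) ∧
      q = (X (Sum.inl i) * X (Sum.inr j)) ^ w (i.1 : ℕ) (j.1 : ℕ)}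

/-- The skew Ferrers graph `G_{λ/μ}`, a bipartite graph on `{x_1,…,x_n} ⊔ {y_1,…,y_m}`. -/
def skewGraph (n : ℕ) (lam mu : ℕ → ℕ) : SimpleGraph (Fin n ⊕ Fin (lam 0)) :=
  SimpleGraph.fromRel fun a b => ∃ (i : Fin n) (j : Fin (lam 0)),
    mu (i : ℕ) ≤ (j : ℕ) ∧ (j : ℕ) < lam (i : ℕ) ∧ a = Sum.inl i ∧ b = Sum.inr j

/-- The edge ideal of a simple graph. -/
def edgeIdeal (k : Type) [Field k] {V : Type} (G : SimpleGraph V) :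
    Ideal (MvPolynomial V k) :=
  Ideal.span {q | ∃ u v, G.Adj u v ∧ q = X u * X v}

/-- The edge ideal of an edge-weighted simple graph. -/
def edgeIdealW (k : Type) [Field k] {V : Type} (G : SimpleGraph V) (w : V → V → ℕ) :
    Ideal (MvPolynomial V k) :=
  Ideal.span {q | ∃ u v, G.Adj u v ∧ q = (X u * X v) ^ w u v}

/-! ### Homological notions -/

/-- The homogeneous maximal ideal of a polynomial ring. -/
def maxIdeal (k : Type) [Field k] (σ : Type) : Ideal (MvPolynomial σ k) :=
  Ideal.span (Set.range (X : σ → MvPolynomial σ k))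

/-- The `i`-th local cohomology of the `R`-module `M` supported at the ideal `J`. -/
def localCoh {R : Type} [CommRing R] (J : Ideal R) (i : ℕ) (M : Type) [AddCommGroup M]
    [Module R M] : ModuleCat R :=
  (localCohomology J i).obj (ModuleCat.of R M)

/-- The Krull dimension of a module, `dim (R / ann M)`. -/
def moduleDim (R : Type) [CommRing R] (M : Type) [AddCommGroup M] [Module R M] :
    WithBot ℕ∞ :=
  ringKrullDim (R ⧸ Module.annihilator R M)

/-- A module `M` is Cohen-Macaulay (w.r.t. the maximal ideal `J`) if
`H^i_J(M) = 0` for all `i < dim M`. -/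
def IsCMModule {R : Type} [CommRing R] (J : Ideal R) (M : Type) [AddCommGroup M]
    [Module R M] : Prop :=
  ∀ i : ℕ, (i : WithBot ℕ∞) < moduleDim R M → IsZero (localCoh J i M)

/-- An ideal `I` is Cohen-Macaulay if `H^i_J(R/I) = 0` for all `i < dim R/I`
(`J` the maximal ideal). -/
def IsCMIdeal {R : Type} [CommRing R] (J I : Ideal R) : Prop :=
  ∀ i : ℕ, (i : WithBot ℕ∞) < ringKrullDim (R ⧸ I) → IsZero (localCoh J i (R ⧸ I))

/-- An ideal `I` is generalized Cohen-Macaulay if `H^i_J(R/I)` has finite length for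
all `i < dim R/I`. -/
def IsGCMIdeal {R : Type} [CommRing R] (J I : Ideal R) : Prop :=
  ∀ i : ℕ, (i : WithBot ℕ∞) < ringKrullDim (R ⧸ I) → IsFiniteLength R (localCoh J i (R ⧸ I))

/-- The canonical map `Ext^i(R/J, M) → H^i_J(M)`, i.e. the structure map of the colimit
defining local cohomology, at the first power of `J`. -/
def extToLocalCoh {R : Type} [CommRing R] (J : Ideal R) (i : ℕ) (M : ModuleCat R) :
    ((localCohomology.diagram (localCohomology.idealPowersDiagram J) i).obj
        (Opposite.op (Opposite.op (1 : ℕ)))).obj M ⟶ (localCohomology J i).obj M :=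
  have := localCohomology.hasColimitDiagram (localCohomology.idealPowersDiagram J) i
  (colimit.ι (localCohomology.diagram (localCohomology.idealPowersDiagram J) i)
    (Opposite.op (Opposite.op (1 : ℕ)))).app M

/-- An ideal `I` is Buchsbaum if the canonical map `Ext^i(R/J, R/I) → H^i_J(R/I)` is
surjective for all `i < dim R/I` (`J` the maximal ideal). -/
def IsBuchsbaumIdeal {R : Type} [CommRing R] (J I : Ideal R) : Prop :=
  ∀ i : ℕ, (i : WithBot ℕ∞) < ringKrullDim (R ⧸ I) →
    Function.Surjective (extToLocalCoh J i (ModuleCat.of R (R ⧸ I)))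

/-- An ideal `I` is unmixed if `dim R/P = dim R/I` for all associated primes `P` of `R/I`. -/
def IsUnmixedIdeal {R : Type} [CommRing R] (I : Ideal R) : Prop :=
  ∀ P ∈ associatedPrimes R (R ⧸ I), ringKrullDim (R ⧸ P) = ringKrullDim (R ⧸ I)

/-- A submodule of `S/J` (`S` a polynomial ring) is graded if it is the image of a
homogeneous ideal of `S`. -/
def IsGradedSubmodule (k σ : Type) [Field k] (J : Ideal (MvPolynomial σ k))
    (N : Submodule (MvPolynomial σ k) (MvPolynomial σ k ⧸ J)) : Prop :=
  letI := MvPolynomial.gradedAlgebra (σ := σ) (R := k)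
  ∃ K : Ideal (MvPolynomial σ k), Ideal.IsHomogeneous (homogeneousSubmodule σ k) K ∧
    ∀ x, x ∈ N ↔ x ∈ K.map (Ideal.Quotient.mk J)

/-- A (homogeneous) ideal `J` of a polynomial ring `S` is sequentially Cohen-Macaulay if
`S/J` admits a filtration `0 = M_0 ⊂ M_1 ⊂ ⋯ ⊂ M_r = S/J` by graded submodules such that
every quotient `M_{i+1}/M_i` is Cohen-Macaulay and the dimensions of the quotients are
strictly increasing. -/
def IsSCMIdeal (k σ : Type) [Field k] (J : Ideal (MvPolynomial σ k)) : Prop :=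
  ∃ (r : ℕ) (M : ℕ → Submodule (MvPolynomial σ k) (MvPolynomial σ k ⧸ J)),
    M 0 = ⊥ ∧ M r = ⊤ ∧ (∀ i, i < r → M i < M (i + 1)) ∧
    (∀ i, i ≤ r → IsGradedSubmodule k σ J (M i)) ∧
    (∀ i, i < r → IsCMModule (maxIdeal k σ)
      (↥(M (i + 1)) ⧸ Submodule.comap (M (i + 1)).subtype (M i))) ∧
    ∀ i, i + 2 ≤ r →
      moduleDim (MvPolynomial σ k)
          (↥(M (i + 1)) ⧸ Submodule.comap (M (i + 1)).subtype (M i)) <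
        moduleDim (MvPolynomial σ k)
          (↥(M (i + 2)) ⧸ Submodule.comap (M (i + 2)).subtype (M (i + 1)))

/-- A graph is sequentially Cohen-Macaulay if its edge ideal is. -/
def IsSCMGraph (k : Type) [Field k] {V : Type} (G : SimpleGraph V) : Prop :=
  IsSCMIdeal k V (edgeIdeal k G)

/-! ### Monomial ideals -/

/-- A monomial of a polynomial ring. -/
def IsMonomial {k σ : Type} [Field k] (u : MvPolynomial σ k) : Prop :=
  ∃ d : σ →₀ ℕ, u = monomial d 1

/-- A monomial ideal of a polynomial ring. -/
def IsMonomialIdeal {k σ : Type} [Field k] (I : Ideal (MvPolynomial σ k)) : Prop :=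
  ∃ T : Set (σ →₀ ℕ), I = Ideal.span ((fun d => (monomial d (1 : k) : MvPolynomial σ k)) '' T)

/-! ### Saturated partitions -/

/-- A partition is saturated if it is either strictly decreasing, or
`{λ_i, λ_i - 1, …, 1} ⊆ {λ_1, …, λ_n}` where `i` is the smallest index with
`λ_i = λ_{i+1}` (0-indexed here). -/
def IsSaturated (n : ℕ) (lam : ℕ → ℕ) : Prop :=
  StrictAntiOn lam (Set.Iio n) ∨
    ∃ i, i + 1 < n ∧ lam i = lam (i + 1) ∧ (∀ j, j < i → lam j ≠ lam (j + 1)) ∧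
      ∀ v, 0 < v → v ≤ lam i → ∃ a, a < n ∧ lam a = v

/-! ### Vertex decomposability -/

/-- A set `T` of vertices is independent in `G`. -/
def IsIndepSet {V : Type} (G : SimpleGraph V) (T : Finset V) : Prop :=
  ∀ u ∈ T, ∀ v ∈ T, ¬G.Adj u v

open Classical in
/-- The induced subgraph of `G` on a finite vertex set `A` is vertex decomposable:
either it has no edges, or it has a shredding vertex `v`, i.e. a vertex such that
`G \ v` and `G \ N[v]` are vertex decomposable and no independent set of `G \ N[v]`
is a maximal independent set of `G \ v`. -/
def IsVertexDecomposable {V : Type} (G : SimpleGraph V) : Finset V → Prop := fun A =>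
  (∀ u ∈ A, ∀ v ∈ A, ¬G.Adj u v) ∨
    ∃ v, ∃ _ : v ∈ A,
      IsVertexDecomposable G (A.erase v) ∧
      IsVertexDecomposable G (A.filter fun u => u ≠ v ∧ ¬G.Adj v u) ∧
      ∀ T ⊆ A.filter fun u => u ≠ v ∧ ¬G.Adj v u, IsIndepSet G T →
        ¬(T ⊆ A.erase v ∧ IsIndepSet G T ∧
            ∀ u ∈ A.erase v, u ∉ T → ∃ t ∈ T, G.Adj u t)
termination_by A => A.card
decreasing_by
  · exact Finset.card_erase_lt_of_mem ‹_›
  · exact Finset.card_lt_card (Finset.filter_ssubset.mpr ⟨v, ‹_›, by simp⟩)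

section ExtSequence

variable {R : Type} [CommRing R]

/-- The cochain map `Hom(L, M) ⟶ Hom(K, N)` induced by `g : K ⟶ L` and `f : M ⟶ N`. -/
def homComplexMap {K L : ChainComplex (ModuleCat R) ℕ} (g : K ⟶ L) {M N : ModuleCat R}
    (f : M ⟶ N) : L.linearYonedaObj R M ⟶ K.linearYonedaObj R N where
  f i := ModuleCat.ofHom (Linear.leftComp R _ (g.f i) ∘ₗ Linear.rightComp R _ f)
  comm' i j _ := by
    ext x
    have h := g.comm j i
    change K.d j i ≫ g.f i ≫ (show L.X i ⟶ M from x) ≫ f =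
      g.f j ≫ (L.d j i ≫ (show L.X i ⟶ M from x)) ≫ f
    rw [Category.assoc, ← Category.assoc, ← h, Category.assoc]

@[simp] lemma homComplexMap_f_apply {K L : ChainComplex (ModuleCat R) ℕ} (g : K ⟶ L)
    {M N : ModuleCat R} (f : M ⟶ N) (i : ℕ) (x : L.X i ⟶ M) :
    ((homComplexMap g f).f i).hom x = g.f i ≫ x ≫ f := by
  change (g.f i ≫ (x ≫ f)) = _
  rfl

lemma homologyUnop_inv_naturality {K L : ChainComplex (ModuleCat R)ᵒᵖ ℕ} (φ : K ⟶ L) (i : ℕ) :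
    (HomologicalComplex.homologyMap φ i).unop ≫ (K.homologyUnop i).inv =
      (L.homologyUnop i).inv ≫ HomologicalComplex.homologyMap
        ((HomologicalComplex.unopFunctor _ _).map φ.op) i := by
  have h := HomologicalComplex.homologyOp_hom_naturality
    ((HomologicalComplex.unopFunctor (ModuleCat R) (ComplexShape.down ℕ)).map φ.op) i
  have h' : (HomologicalComplex.homologyOp K.unop i).inv ≫ HomologicalComplex.homologyMap φ i =
      (HomologicalComplex.homologyMap
        ((HomologicalComplex.unopFunctor (ModuleCat R) (ComplexShape.down ℕ)).map φ.op) i).op ≫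
      (HomologicalComplex.homologyOp L.unop i).inv := by
    refine (Iso.inv_comp_eq _).2 ?_
    refine Eq.trans ?_ (Category.assoc _ _ _)
    exact (Iso.eq_comp_inv _).2 h
  exact congrArg Quiver.Hom.unop h'

lemma isoExt_hom_naturality {X Y M : ModuleCat R} (P : ProjectiveResolution X)
    (Q : ProjectiveResolution Y) (h : X ⟶ Y) (g : P.complex ⟶ Q.complex)
    (comm : g.f 0 ≫ Q.π.f 0 = P.π.f 0 ≫ h) (i : ℕ) :
    ((Ext R (ModuleCat R) i).map h.op).app M ≫ (P.isoExt (R := R) i M).hom =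
    (Q.isoExt i M).hom ≫ HomologicalComplex.homologyMap (homComplexMap g (𝟙 M)) i := by
  have h1 := congrArg Quiver.Hom.unop (P.isoLeftDerivedObj_inv_naturality h Q g comm
    ((linearYoneda R (ModuleCat R)).obj M).rightOp i)
  have h2 := homologyUnop_inv_naturality
    ((((linearYoneda R (ModuleCat R)).obj M).rightOp.mapHomologicalComplex _).map g) i
  refine Eq.trans (Category.assoc _ _ _).symm ?_
  refine Eq.trans (congrArg (· ≫ _) h1) ?_
  refine Eq.trans (Category.assoc _ _ _) ?_
  refine Eq.trans (congrArg (_ ≫ ·) h2) ?_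
  refine Eq.trans (Category.assoc _ _ _).symm ?_
  refine congrArg₂ (· ≫ ·) rfl ?_
  congr 1

lemma isoExt_hom_naturality_right {X M N : ModuleCat R} (P : ProjectiveResolution X)
    (f : M ⟶ N) (i : ℕ) :
    ((Ext R (ModuleCat R) i).obj (.op X)).map f ≫ (P.isoExt (R := R) i N).hom =
    (P.isoExt i M).hom ≫ HomologicalComplex.homologyMap (homComplexMap (𝟙 P.complex) f) i := by
  have h1 := congrArg Quiver.Hom.unop ((Iso.inv_comp_eq _).2
    (P.leftDerived_app_eq (NatTrans.rightOp ((linearYoneda R (ModuleCat R)).map f)) i))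
  have h2 := homologyUnop_inv_naturality ((NatTrans.mapHomologicalComplex
    (NatTrans.rightOp ((linearYoneda R (ModuleCat R)).map f)) _).app P.complex) i
  refine Eq.trans (Category.assoc _ _ _).symm ?_
  refine Eq.trans (congrArg (· ≫ _) h1) ?_
  refine Eq.trans (Category.assoc _ _ _) ?_
  refine Eq.trans (congrArg (_ ≫ ·) h2) ?_
  refine Eq.trans (Category.assoc _ _ _).symm ?_
  refine congrArg₂ (· ≫ ·) rfl ?_
  congr 1

lemma homComplexMap_comp {K L T : ChainComplex (ModuleCat R) ℕ} (g : K ⟶ L) (g' : L ⟶ T)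
    {M N Q : ModuleCat R} (f : M ⟶ N) (f' : N ⟶ Q) :
    homComplexMap g' f ≫ homComplexMap g f' = homComplexMap (g ≫ g') (f ≫ f') := by
  ext i x
  have key : ∀ x : T.X i ⟶ M,
      g.f i ≫ (g'.f i ≫ x ≫ f) ≫ f' = (g.f i ≫ g'.f i) ≫ x ≫ f ≫ f' := by
    intro x
    simp only [Category.assoc]
  exact key x

lemma homComplexMap_smul (K : ChainComplex (ModuleCat R) ℕ) (M : ModuleCat R) (r : R) :
    homComplexMap (𝟙 K) (r • 𝟙 M) = r • 𝟙 (K.linearYonedaObj R M) := by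
  ext i x
  have key : ∀ x : K.X i ⟶ M, 𝟙 (K.X i) ≫ x ≫ (r • 𝟙 M) = r • x := by
    intro x
    simp
  exact key x

/-- The sequence `Hom(K, M₁) ⟶ Hom(K, M₂) ⟶ Hom(K, M₃)` of cochain complexes. -/
def homShortComplex (K : ChainComplex (ModuleCat R) ℕ) (S : ShortComplex (ModuleCat R)) :
    ShortComplex (CochainComplex (ModuleCat R) ℕ) :=
  ShortComplex.mk (homComplexMap (𝟙 K) S.f) (homComplexMap (𝟙 K) S.g) (by
    rw [homComplexMap_comp, S.zero]
    ext i x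
    have key : ∀ x : K.X i ⟶ S.X₁, (𝟙 K ≫ 𝟙 K : K ⟶ K).f i ≫ x ≫ (0 : S.X₁ ⟶ S.X₃) = 0 := by
      intro x
      simp
    exact key x)

/-- Functoriality of `homShortComplex` in the complex. -/
def homShortComplexMap {K L : ChainComplex (ModuleCat R) ℕ} (g : K ⟶ L)
    (S : ShortComplex (ModuleCat R)) : homShortComplex L S ⟶ homShortComplex K S where
  τ₁ := homComplexMap g (𝟙 _)
  τ₂ := homComplexMap g (𝟙 _)
  τ₃ := homComplexMap g (𝟙 _)
  comm₁₂ := by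
    refine (homComplexMap_comp _ _ _ _).trans (Eq.trans ?_ (homComplexMap_comp _ _ _ _).symm)
    simp
  comm₂₃ := by
    refine (homComplexMap_comp _ _ _ _).trans (Eq.trans ?_ (homComplexMap_comp _ _ _ _).symm)
    simp

lemma homShortComplex_shortExact {X : ModuleCat R} (P : ProjectiveResolution X)
    {S : ShortComplex (ModuleCat R)} (hS : S.ShortExact) :
    (homShortComplex P.complex S).ShortExact := by
  have := hS.mono_f
  have := hS.epi_g
  refine HomologicalComplex.shortExact_of_degreewise_shortExact _ fun i => ?_
  have := P.projective i
  refine ModuleCat.shortComplex_shortExact _ ?_ ?_ ?_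
  · intro y
    change (P.complex.X i ⟶ S.X₂) at y
    constructor
    · intro h
      change 𝟙 (P.complex.X i) ≫ y ≫ S.g = 0 at h
      rw [Category.id_comp] at h
      refine ⟨hS.exact.lift y h, ?_⟩
      change 𝟙 (P.complex.X i) ≫ hS.exact.lift y h ≫ S.f = y
      simp
    · rintro ⟨x, rfl⟩
      have key : ∀ x : P.complex.X i ⟶ S.X₁,
          𝟙 (P.complex.X i) ≫ (𝟙 (P.complex.X i) ≫ x ≫ S.f) ≫ S.g = 0 := by
        intro x
        simp
      exact key x
  · intro x y h
    change (P.complex.X i ⟶ S.X₁) at x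
    change (P.complex.X i ⟶ S.X₁) at y
    change 𝟙 (P.complex.X i) ≫ x ≫ S.f = 𝟙 (P.complex.X i) ≫ y ≫ S.f at h
    rw [Category.id_comp, Category.id_comp, cancel_mono] at h
    exact h
  · intro z
    change (P.complex.X i ⟶ S.X₃) at z
    refine ⟨Projective.factorThru z S.g, ?_⟩
    change 𝟙 (P.complex.X i) ≫ Projective.factorThru z S.g ≫ S.g = z
    simp

lemma hom_injective_of_iso {A B : ModuleCat R} (e : A ≅ B) : Function.Injective e.hom :=
  (ConcreteCategory.bijective_of_isIso e.hom).1

lemma up_nat_rel (i : ℕ) : (ComplexShape.up ℕ).Rel i (i + 1) := by simp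

/-- The connecting homomorphism `Ext^i(X, M₃) ⟶ Ext^{i+1}(X, M₁)`. -/
def extδ (X : ModuleCat R) {S : ShortComplex (ModuleCat R)} (hS : S.ShortExact) (i : ℕ) :
    ((Ext R (ModuleCat R) i).obj (.op X)).obj S.X₃ ⟶
      ((Ext R (ModuleCat R) (i + 1)).obj (.op X)).obj S.X₁ :=
  ((projectiveResolution X).isoExt i S.X₃).hom ≫
    (homShortComplex_shortExact (projectiveResolution X) hS).δ i (i + 1) (up_nat_rel i) ≫
    ((projectiveResolution X).isoExt (i + 1) S.X₁).inv

lemma conj_naturality {A A' B B' C C' D D' : ModuleCat R} (eA : A ≅ A') (eB : B ≅ B')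
    (eC : C ≅ C') (eD : D ≅ D') {d : A' ⟶ B'} {d' : C' ⟶ D'} {p : B ⟶ D} {q : A ⟶ C}
    {p' : B' ⟶ D'} {q' : A' ⟶ C'} (hp : p ≫ eD.hom = eB.hom ≫ p')
    (hq : q ≫ eC.hom = eA.hom ≫ q') (h : d ≫ p' = q' ≫ d') :
    (eA.hom ≫ d ≫ eB.inv) ≫ p = q ≫ eC.hom ≫ d' ≫ eD.inv := by
  have hp' : eB.inv ≫ p = p' ≫ eD.inv := by
    rw [Iso.inv_comp_eq, ← Category.assoc, Iso.eq_comp_inv, hp]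
  rw [Category.assoc, Category.assoc, hp', ← Category.assoc q, hq, Category.assoc,
    ← Category.assoc d, h, Category.assoc]

lemma extδ_naturality {X Y : ModuleCat R} (h : X ⟶ Y) {S : ShortComplex (ModuleCat R)}
    (hS : S.ShortExact) (i : ℕ) :
    extδ Y hS i ≫ ((Ext R (ModuleCat R) (i + 1)).map h.op).app S.X₁ =
      ((Ext R (ModuleCat R) i).map h.op).app S.X₃ ≫ extδ X hS i := by
  let P := projectiveResolution X
  let Q := projectiveResolution Y
  let g : P.complex ⟶ Q.complex := ProjectiveResolution.lift h P Q
  have comm : g.f 0 ≫ Q.π.f 0 = P.π.f 0 ≫ h := ProjectiveResolution.lift_commutes_zero h P Q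
  exact conj_naturality _ _ _ _ (isoExt_hom_naturality (M := S.X₁) P Q h g comm (i + 1))
    (isoExt_hom_naturality (M := S.X₃) P Q h g comm i)
    (HomologicalComplex.HomologySequence.δ_naturality (homShortComplexMap g S)
      (homShortComplex_shortExact Q hS) (homShortComplex_shortExact P hS) i (i + 1) (up_nat_rel i))

lemma conj_exact {A B C A' B' C' : ModuleCat R} (eA : A ≅ A') (eB : B ≅ B') (eC : C ≅ C')
    {f : A ⟶ B} {g : B ⟶ C} {f' : A' ⟶ B'} {g' : B' ⟶ C'} (hf : f ≫ eB.hom = eA.hom ≫ f')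
    (hg : g ≫ eC.hom = eB.hom ≫ g') {hz : f' ≫ g' = 0} (hex : (ShortComplex.mk f' g' hz).Exact)
    (z : B) : g z = 0 ↔ ∃ y, f y = z := by
  have h0 : f ≫ g = 0 := by
    rw [← cancel_mono eC.hom, Category.assoc, hg, ← Category.assoc, hf, Category.assoc, hz]
    simp
  have hex' : (ShortComplex.mk f g h0).Exact :=
    (ShortComplex.exact_iff_of_iso (ShortComplex.isoMk eA eB eC hf.symm hg.symm)).2 hex
  constructor
  · exact (ShortComplex.moduleCat_exact_iff _).1 hex' z
  · rintro ⟨y, rfl⟩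
    exact ConcreteCategory.congr_hom h0 y

lemma extδ_comp_isoExt (X : ModuleCat R) {S : ShortComplex (ModuleCat R)}
    (hS : S.ShortExact) (i : ℕ) :
    extδ X hS i ≫ ((projectiveResolution X).isoExt (i + 1) S.X₁).hom =
      ((projectiveResolution X).isoExt i S.X₃).hom ≫
      (homShortComplex_shortExact (projectiveResolution X) hS).δ i (i + 1) (up_nat_rel i) := by
  refine (Category.assoc _ _ _).trans ?_
  refine congrArg (_ ≫ ·) ?_
  refine (Category.assoc _ _ _).trans ?_
  erw [Iso.inv_hom_id, Category.comp_id]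

lemma extδ_apply_eq_zero_iff (X : ModuleCat R) {S : ShortComplex (ModuleCat R)}
    (hS : S.ShortExact) (i : ℕ) (z : ((Ext R (ModuleCat R) i).obj (.op X)).obj S.X₃) :
    extδ X hS i z = 0 ↔ ∃ y, ((Ext R (ModuleCat R) i).obj (.op X)).map S.g y = z :=
  conj_exact _ _ _ (isoExt_hom_naturality_right _ S.g i) (extδ_comp_isoExt X hS i)
    ((homShortComplex_shortExact (projectiveResolution X) hS).homology_exact₃ i (i + 1)
      (up_nat_rel i)) z

lemma ext_map_f_apply_eq_zero_iff (X : ModuleCat R) {S : ShortComplex (ModuleCat R)}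
    (hS : S.ShortExact) (i : ℕ) (z : ((Ext R (ModuleCat R) (i + 1)).obj (.op X)).obj S.X₁) :
    ((Ext R (ModuleCat R) (i + 1)).obj (.op X)).map S.f z = 0 ↔ ∃ y, extδ X hS i y = z :=
  conj_exact _ _ _ (extδ_comp_isoExt X hS i)
    (isoExt_hom_naturality_right (projectiveResolution X) S.f (i + 1))
    ((homShortComplex_shortExact (projectiveResolution X) hS).homology_exact₁ i (i + 1)
      (up_nat_rel i)) z

lemma ext_map_g_apply_eq_zero_iff (X : ModuleCat R) {S : ShortComplex (ModuleCat R)}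
    (hS : S.ShortExact) (i : ℕ) (z : ((Ext R (ModuleCat R) i).obj (.op X)).obj S.X₂) :
    ((Ext R (ModuleCat R) i).obj (.op X)).map S.g z = 0 ↔
      ∃ y, ((Ext R (ModuleCat R) i).obj (.op X)).map S.f y = z :=
  conj_exact _ _ _ (isoExt_hom_naturality_right _ S.f i)
    (isoExt_hom_naturality_right (projectiveResolution X) S.g i)
    ((homShortComplex_shortExact (projectiveResolution X) hS).homology_exact₂ i) z

lemma cochain_homologyMap_smul {K L : CochainComplex (ModuleCat R) ℕ} (r : R) (f : K ⟶ L)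
    (i : ℕ) : HomologicalComplex.homologyMap (r • f) i = r • HomologicalComplex.homologyMap f i :=
  ShortComplex.homologyMap_smul
    (φ := (HomologicalComplex.shortComplexFunctor (ModuleCat R) (.up ℕ) i).map f) r

lemma ext_map_smul_apply (X M : ModuleCat R) (r : R) (i : ℕ)
    (z : ((Ext R (ModuleCat R) i).obj (.op X)).obj M) :
    ((Ext R (ModuleCat R) i).obj (.op X)).map (r • 𝟙 M) z = r • z := by
  have h := isoExt_hom_naturality_right (projectiveResolution X) (r • 𝟙 M) i
  rw [homComplexMap_smul, cochain_homologyMap_smul,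
    HomologicalComplex.homologyMap_id] at h
  apply hom_injective_of_iso ((projectiveResolution X).isoExt i M)
  refine (ConcreteCategory.congr_hom h z).trans ?_
  simp

lemma ext_smul_eq_zero (X M : ModuleCat R) (r : R) (hr : ∀ x : X, r • x = 0) (i : ℕ)
    (z : ((Ext R (ModuleCat R) i).obj (.op X)).obj M) : r • z = 0 := by
  let P := projectiveResolution X
  have h0 : r • 𝟙 X = 0 := by
    ext x
    exact hr x
  have hcomm : ∀ {A B : ModuleCat R} (p : A ⟶ B), (r • 𝟙 A) ≫ p = p ≫ (r • 𝟙 B) := by simp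
  have hcomm₀ : ∀ {A : ModuleCat R} (p : A ⟶ X), (0 : A ⟶ A) ≫ p = p ≫ (r • 𝟙 X) := by simp [h0]
  have h1 := isoExt_hom_naturality (M := M) P P (r • 𝟙 X) (r • 𝟙 P.complex) (hcomm _) i
  have h2 := isoExt_hom_naturality (M := M) P P (r • 𝟙 X) 0 (hcomm₀ _) i
  have h3 : homComplexMap (0 : P.complex ⟶ P.complex) (𝟙 M) = 0 := by
    ext i x
    have key : ∀ x : P.complex.X i ⟶ M, (0 : P.complex.X i ⟶ P.complex.X i) ≫ x ≫ 𝟙 M = 0 := by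
      intro x
      simp
    exact key x
  have h4 : homComplexMap (r • 𝟙 P.complex) (𝟙 M) = r • 𝟙 _ := by
    ext i x
    have key : ∀ x : P.complex.X i ⟶ M, (r • 𝟙 (P.complex.X i)) ≫ x ≫ 𝟙 M = r • x := by
      intro x
      simp
    exact key x
  have h5 := h1.symm.trans h2
  rw [h3, h4, cochain_homologyMap_smul, HomologicalComplex.homologyMap_id,
    HomologicalComplex.homologyMap_zero] at h5
  have h6 := ConcreteCategory.congr_hom h5 z
  apply hom_injective_of_iso (P.isoExt i M)
  rw [map_zero]
  refine Eq.trans ?_ (h6.trans ?_)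
  · simp
  · simp

end ExtSequence

section ExtZero

variable {R : Type} [CommRing R]

/-- The embedding of the zeroth cohomology of a cochain complex into its degree zero part. -/
def homologyZeroι (K : CochainComplex (ModuleCat.{0} R) ℕ) : K.homology 0 ⟶ K.X 0 :=
  K.isoHomologyπ₀.inv ≫ K.iCycles 0

instance (K : CochainComplex (ModuleCat.{0} R) ℕ) : Mono (homologyZeroι K) := by
  unfold homologyZeroι
  infer_instance

lemma homologyZeroι_naturality {K L : CochainComplex (ModuleCat.{0} R) ℕ} (φ : K ⟶ L) :
    HomologicalComplex.homologyMap φ 0 ≫ homologyZeroι L = homologyZeroι K ≫ φ.f 0 := by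
  unfold homologyZeroι
  rw [← Category.assoc, CochainComplex.isoHomologyπ₀_inv_naturality, Category.assoc,
    HomologicalComplex.cyclesMap_i, Category.assoc]

lemma homologyZeroι_d (K : CochainComplex (ModuleCat.{0} R) ℕ) :
    homologyZeroι K ≫ K.d 0 1 = 0 := by
  unfold homologyZeroι
  rw [Category.assoc, HomologicalComplex.iCycles_d, comp_zero]

lemma exists_homologyZeroι_eq (K : CochainComplex (ModuleCat.{0} R) ℕ) (x : K.X 0)
    (hx : K.d 0 1 x = 0) : ∃ z, homologyZeroι K z = x := by
  let p : ModuleCat.of R R ⟶ K.X 0 := ModuleCat.ofHom (LinearMap.toSpanSingleton R _ x)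
  have hp : p ≫ K.d 0 1 = 0 := by
    ext
    simpa [p] using hx
  refine ⟨(K.liftCycles p 1 (by simp) hp ≫ K.isoHomologyπ₀.hom) (1 : R), ?_⟩
  have h : (K.liftCycles p 1 (by simp) hp ≫ K.isoHomologyπ₀.hom) ≫ homologyZeroι K = p := by
    simp [homologyZeroι]
  refine (ConcreteCategory.congr_hom h (1 : R)).trans ?_
  simp [p]

lemma exists_extZeroHom {X M : ModuleCat.{0} R} (z : ((Ext R (ModuleCat R) 0).obj (.op X)).obj M) :
    ∃ φ : X ⟶ M, homologyZeroι _ (((projectiveResolution X).isoExt 0 M).hom z) =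
      (show (projectiveResolution X).complex.X 0 ⟶ X from (projectiveResolution X).π.f 0) ≫ φ := by
  let P := projectiveResolution X
  let y : P.complex.X 0 ⟶ M := homologyZeroι _ ((P.isoExt 0 M).hom z)
  have hy : P.complex.d 1 0 ≫ y = 0 :=
    ConcreteCategory.congr_hom (homologyZeroι_d (P.complex.linearYonedaObj R M)) _
  exact ⟨P.exact₀.desc y hy, (P.exact₀.g_desc y hy).symm⟩

/-- The homomorphism corresponding to an element of `Ext^0`. -/
def extZeroHom {X M : ModuleCat.{0} R} (z : ((Ext R (ModuleCat R) 0).obj (.op X)).obj M) : X ⟶ M :=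
  (exists_extZeroHom z).choose

lemma extZeroHom_spec {X M : ModuleCat.{0} R} (z : ((Ext R (ModuleCat R) 0).obj (.op X)).obj M) :
    homologyZeroι _ (((projectiveResolution X).isoExt 0 M).hom z) =
      (show (projectiveResolution X).complex.X 0 ⟶ X from (projectiveResolution X).π.f 0) ≫
        extZeroHom z :=
  (exists_extZeroHom z).choose_spec

lemma extZeroHom_eq {X M : ModuleCat.{0} R} {z : ((Ext R (ModuleCat R) 0).obj (.op X)).obj M}
    {φ : X ⟶ M} (h : homologyZeroι _ (((projectiveResolution X).isoExt 0 M).hom z) =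
      (show (projectiveResolution X).complex.X 0 ⟶ X from (projectiveResolution X).π.f 0) ≫ φ) :
    extZeroHom z = φ := by
  have : Epi (show (projectiveResolution X).complex.X 0 ⟶ X from (projectiveResolution X).π.f 0) :=
    inferInstanceAs (Epi ((projectiveResolution X).π.f 0))
  exact (cancel_epi _).1 ((extZeroHom_spec z).symm.trans h)

lemma extZeroHom_injective {X M : ModuleCat.{0} R} :
    Function.Injective (extZeroHom (X := X) (M := M)) := by
  intro z w h
  apply hom_injective_of_iso ((projectiveResolution X).isoExt 0 M)
  apply (ModuleCat.mono_iff_injective (homologyZeroι _)).1 inferInstance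
  exact (extZeroHom_spec z).trans ((congrArg _ h).trans (extZeroHom_spec w).symm)

lemma extZeroHom_surjective {X M : ModuleCat.{0} R} :
    Function.Surjective (extZeroHom (X := X) (M := M)) := by
  intro φ
  let P := projectiveResolution X
  let p : P.complex.X 0 ⟶ X := P.π.f 0
  have hp : P.complex.d 1 0 ≫ p = 0 := P.complex_d_comp_π_f_zero
  obtain ⟨z, hz⟩ := exists_homologyZeroι_eq (P.complex.linearYonedaObj R M)
    (show P.complex.X 0 ⟶ M from p ≫ φ) (by
      have : P.complex.d 1 0 ≫ p ≫ φ = 0 := by rw [← Category.assoc, hp, zero_comp]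
      exact this)
  refine ⟨(P.isoExt 0 M).inv z, extZeroHom_eq ?_⟩
  refine Eq.trans (congrArg _ ?_) hz
  exact ConcreteCategory.congr_hom (P.isoExt 0 M).inv_hom_id z

lemma extZeroHom_zero {X M : ModuleCat.{0} R} :
    extZeroHom (0 : ((Ext R (ModuleCat R) 0).obj (.op X)).obj M) = 0 := by
  apply extZeroHom_eq
  rw [map_zero, map_zero, comp_zero]
  rfl

lemma extZeroHom_smul {X M : ModuleCat.{0} R} (r : R)
    (z : ((Ext R (ModuleCat R) 0).obj (.op X)).obj M) :
    extZeroHom (r • z) = r • extZeroHom z := by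
  apply extZeroHom_eq
  rw [map_smul, map_smul, extZeroHom_spec, Linear.comp_smul]
  rfl

lemma extZeroHom_map {X M N : ModuleCat R} (f : M ⟶ N)
    (z : ((Ext R (ModuleCat R) 0).obj (.op X)).obj M) :
    extZeroHom (((Ext R (ModuleCat R) 0).obj (.op X)).map f z) = extZeroHom z ≫ f := by
  apply extZeroHom_eq
  let P := projectiveResolution X
  have h1 := ConcreteCategory.congr_hom (isoExt_hom_naturality_right P f 0) z
  have h2 := ConcreteCategory.congr_hom
    (homologyZeroι_naturality (homComplexMap (𝟙 P.complex) f)) ((P.isoExt 0 M).hom z)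
  refine (congrArg (homologyZeroι _) h1).trans (h2.trans ?_)
  refine (congrArg ((homComplexMap (𝟙 P.complex) f).f 0) (extZeroHom_spec z)).trans ?_
  have key : ∀ x : P.complex.X 0 ⟶ X, 𝟙 (P.complex.X 0) ≫ (x ≫ extZeroHom z) ≫ f =
    x ≫ extZeroHom z ≫ f := by simp
  exact key _

lemma extZeroHom_map_op {X Y M : ModuleCat R} (h : X ⟶ Y)
    (z : ((Ext R (ModuleCat R) 0).obj (.op Y)).obj M) :
    extZeroHom (((Ext R (ModuleCat R) 0).map h.op).app M z) = h ≫ extZeroHom z := by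
  apply extZeroHom_eq
  let P := projectiveResolution X
  let Q := projectiveResolution Y
  let g : P.complex ⟶ Q.complex := ProjectiveResolution.lift h P Q
  have comm : g.f 0 ≫ Q.π.f 0 = P.π.f 0 ≫ h := ProjectiveResolution.lift_commutes_zero h P Q
  have h1 := ConcreteCategory.congr_hom (isoExt_hom_naturality (M := M) P Q h g comm 0) z
  have h2 := ConcreteCategory.congr_hom
    (homologyZeroι_naturality (homComplexMap g (𝟙 M))) ((Q.isoExt 0 M).hom z)
  refine (congrArg (homologyZeroι _) h1).trans (h2.trans ?_)
  refine (congrArg ((homComplexMap g (𝟙 M)).f 0) (extZeroHom_spec z)).trans ?_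
  have key : ∀ (p : P.complex.X 0 ⟶ X) (q : Q.complex.X 0 ⟶ Y), g.f 0 ≫ q = p ≫ h →
      g.f 0 ≫ (q ≫ extZeroHom z) ≫ 𝟙 M = p ≫ h ≫ extZeroHom z := by
    intro p q hpq
    rw [Category.comp_id, ← Category.assoc, hpq, Category.assoc]
  exact key _ _ comm

end ExtZero

section LocalCohomology

variable {R : Type} [CommRing R] (J : Ideal R)

/-- The module `R / J ^ t`. -/
abbrev powQuot (t : ℕ) : ModuleCat.{0} R := ModuleCat.of R (R ⧸ J ^ t)

/-- The projection `R / J ^ t ⟶ R / J ^ s` for `s ≤ t`. -/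
def powQuotMap {s t : ℕ} (h : s ≤ t) : powQuot J t ⟶ powQuot J s :=
  (localCohomology.ringModIdeals (localCohomology.idealPowersDiagram J)).map (homOfLE h).op

/-- The canonical map `Ext^i(R / J ^ t, M) ⟶ H^i_J(M)`. -/
def stage (i t : ℕ) (M : ModuleCat.{0} R) :
    ((Ext R (ModuleCat R) i).obj (.op (powQuot J t))).obj M ⟶ (localCohomology J i).obj M :=
  have := localCohomology.hasColimitDiagram (localCohomology.idealPowersDiagram J) i
  (colimit.ι (localCohomology.diagram (localCohomology.idealPowersDiagram J) i)
    (Opposite.op (Opposite.op t))).app M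

lemma stage_naturality (i t : ℕ) {M N : ModuleCat.{0} R} (f : M ⟶ N) :
    ((Ext R (ModuleCat R) i).obj (.op (powQuot J t))).map f ≫ stage J i t N =
      stage J i t M ≫ (localCohomology J i).map f :=
  have := localCohomology.hasColimitDiagram (localCohomology.idealPowersDiagram J) i
  (colimit.ι (localCohomology.diagram (localCohomology.idealPowersDiagram J) i)
    (Opposite.op (Opposite.op t))).naturality f

lemma map_powQuotMap_stage (i : ℕ) {s t : ℕ} (h : s ≤ t) (M : ModuleCat.{0} R) :
    ((Ext R (ModuleCat R) i).map (powQuotMap J h).op).app M ≫ stage J i t M = stage J i s M :=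
  have := localCohomology.hasColimitDiagram (localCohomology.idealPowersDiagram J) i
  congr_app (colimit.w (localCohomology.diagram (localCohomology.idealPowersDiagram J) i)
    (homOfLE h).op.op) M

lemma exists_stage_eq (i : ℕ) (M : ModuleCat.{0} R) (z : (localCohomology J i).obj M) :
    ∃ t w, stage J i t M w = z := by
  have := localCohomology.hasColimitDiagram (localCohomology.idealPowersDiagram J) i
  let F := localCohomology.diagram (localCohomology.idealPowersDiagram J) i
  let c := ((evaluation (ModuleCat R) (ModuleCat R)).obj M).mapCocone (colimit.cocone F)
  have hc : IsColimit c := isColimitOfPreserves _ (colimit.isColimit F)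
  obtain ⟨t, w, hw⟩ := Concrete.isColimit_exists_rep _ hc z
  exact ⟨t.unop.unop, w, hw⟩

lemma exists_le_of_stage_eq_zero (i t : ℕ) (M : ModuleCat.{0} R)
    (w : ((Ext R (ModuleCat R) i).obj (.op (powQuot J t))).obj M) (hw : stage J i t M w = 0) :
    ∃ (s : ℕ) (h : t ≤ s), ((Ext R (ModuleCat R) i).map (powQuotMap J h).op).app M w = 0 := by
  have := localCohomology.hasColimitDiagram (localCohomology.idealPowersDiagram J) i
  let F := localCohomology.diagram (localCohomology.idealPowersDiagram J) i
  let c := ((evaluation (ModuleCat R) (ModuleCat R)).obj M).mapCocone (colimit.cocone F)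
  have hc : IsColimit c := isColimitOfPreserves _ (colimit.isColimit F)
  obtain ⟨s, f, g, h⟩ := Concrete.isColimit_exists_of_rep_eq
    (F ⋙ (evaluation (ModuleCat R) (ModuleCat R)).obj M) hc
    (i := Opposite.op (Opposite.op t)) (j := Opposite.op (Opposite.op t)) w 0 (by
      rw [map_zero]
      exact hw)
  refine ⟨s.unop.unop, leOfHom f.unop.unop, ?_⟩
  rw [map_zero] at h
  exact h

lemma exists_stage_eq_of_le (i t : ℕ) (M : ModuleCat.{0} R) (z : (localCohomology J i).obj M) :
    ∃ s ≥ t, ∃ w, stage J i s M w = z := by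
  obtain ⟨s, w, rfl⟩ := exists_stage_eq J i M z
  refine ⟨max s t, le_max_right _ _,
    ((Ext R (ModuleCat R) i).map (powQuotMap J (le_max_left s t)).op).app M w, ?_⟩
  exact ConcreteCategory.congr_hom (map_powQuotMap_stage J i (le_max_left s t) M) w

end LocalCohomology

section LocalCohomologySequence

variable {R : Type} [CommRing R] (J : Ideal R) {S : ShortComplex (ModuleCat.{0} R)}
  (hS : S.ShortExact)

/-- Local cohomology of a fixed module, as the colimit of its stages. -/
def stageIsColimit (i : ℕ) (M : ModuleCat.{0} R) :
    have := localCohomology.hasColimitDiagram (localCohomology.idealPowersDiagram J) i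
    IsColimit (((evaluation (ModuleCat R) (ModuleCat R)).obj M).mapCocone (colimit.cocone
      (localCohomology.diagram (localCohomology.idealPowersDiagram J) i))) :=
  have := localCohomology.hasColimitDiagram (localCohomology.idealPowersDiagram J) i
  isColimitOfPreserves _ (colimit.isColimit _)

/-- The cocone defining the connecting homomorphism in local cohomology. -/
def δCocone (i : ℕ) :
    Cocone (localCohomology.diagram (localCohomology.idealPowersDiagram J) i ⋙
      (evaluation (ModuleCat R) (ModuleCat R)).obj S.X₃) where
  pt := (localCohomology J (i + 1)).obj S.X₁
  ι :=
    { app := fun t => extδ (powQuot J t.unop.unop) hS i ≫ stage J (i + 1) t.unop.unop S.X₁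
      naturality := fun s t f => by
        have h := extδ_naturality (powQuotMap J (leOfHom f.unop.unop)) hS i
        have h' := map_powQuotMap_stage J (i + 1) (leOfHom f.unop.unop) S.X₁
        change ((Ext R (ModuleCat R) i).map (powQuotMap J (leOfHom f.unop.unop)).op).app S.X₃ ≫
          extδ _ hS i ≫ stage J (i + 1) t.unop.unop S.X₁ =
          (extδ _ hS i ≫ stage J (i + 1) s.unop.unop S.X₁) ≫ 𝟙 _
        rw [Category.comp_id, ← h', ← Category.assoc, ← h, Category.assoc] }

/-- The connecting homomorphism in local cohomology. -/
def lcδ (i : ℕ) : (localCohomology J i).obj S.X₃ ⟶ (localCohomology J (i + 1)).obj S.X₁ :=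
  (stageIsColimit J i S.X₃).desc (δCocone J hS i)

lemma stage_lcδ (i t : ℕ) :
    stage J i t S.X₃ ≫ lcδ J hS i = extδ (powQuot J t) hS i ≫ stage J (i + 1) t S.X₁ :=
  (stageIsColimit J i S.X₃).fac (δCocone J hS i) (Opposite.op (Opposite.op t))

lemma stage_lcδ_apply (i t : ℕ) (w : ((Ext R (ModuleCat R) i).obj (.op (powQuot J t))).obj S.X₃) :
    lcδ J hS i (stage J i t S.X₃ w) = stage J (i + 1) t S.X₁ (extδ (powQuot J t) hS i w) :=
  ConcreteCategory.congr_hom (stage_lcδ J hS i t) w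

lemma map_stage_apply (i t : ℕ) {M N : ModuleCat.{0} R} (f : M ⟶ N)
    (w : ((Ext R (ModuleCat R) i).obj (.op (powQuot J t))).obj M) :
    (localCohomology J i).map f (stage J i t M w) =
      stage J i t N (((Ext R (ModuleCat R) i).obj (.op (powQuot J t))).map f w) :=
  (ConcreteCategory.congr_hom (stage_naturality J i t f) w).symm

lemma stage_powQuotMap_apply (i : ℕ) {s t : ℕ} (h : s ≤ t) (M : ModuleCat.{0} R)
    (w : ((Ext R (ModuleCat R) i).obj (.op (powQuot J s))).obj M) :
    stage J i t M (((Ext R (ModuleCat R) i).map (powQuotMap J h).op).app M w) =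
      stage J i s M w :=
  ConcreteCategory.congr_hom (map_powQuotMap_stage J i h M) w

lemma lcδ_apply_eq_zero_iff (i : ℕ) (z : (localCohomology J i).obj S.X₃) :
    lcδ J hS i z = 0 ↔ ∃ y, (localCohomology J i).map S.g y = z := by
  constructor
  · intro h
    obtain ⟨t, w, rfl⟩ := exists_stage_eq J i _ z
    rw [stage_lcδ_apply] at h
    obtain ⟨s, hs, h0⟩ := exists_le_of_stage_eq_zero J _ _ _ _ h
    have h1 := ConcreteCategory.congr_hom (extδ_naturality (powQuotMap J hs) hS i) w
    obtain ⟨y, hy⟩ := (extδ_apply_eq_zero_iff _ hS i _).1 (h1.symm.trans h0)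
    refine ⟨stage J i s _ y, ?_⟩
    rw [map_stage_apply, hy]
    exact stage_powQuotMap_apply J i hs _ w
  · rintro ⟨y, rfl⟩
    obtain ⟨t, w, rfl⟩ := exists_stage_eq J i _ y
    rw [map_stage_apply, stage_lcδ_apply, (extδ_apply_eq_zero_iff _ hS i _).2 ⟨w, rfl⟩, map_zero]

lemma lc_map_f_apply_eq_zero_iff (i : ℕ) (z : (localCohomology J (i + 1)).obj S.X₁) :
    (localCohomology J (i + 1)).map S.f z = 0 ↔ ∃ y, lcδ J hS i y = z := by
  constructor
  · intro h
    obtain ⟨t, w, rfl⟩ := exists_stage_eq J (i + 1) _ z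
    rw [map_stage_apply] at h
    obtain ⟨s, hs, h0⟩ := exists_le_of_stage_eq_zero J _ _ _ _ h
    have h1 := ConcreteCategory.congr_hom
      (((Ext R (ModuleCat R) (i + 1)).map (powQuotMap J hs).op).naturality S.f) w
    obtain ⟨y, hy⟩ := (ext_map_f_apply_eq_zero_iff _ hS i _).1 (h1.symm.trans h0)
    refine ⟨stage J i s _ y, ?_⟩
    rw [stage_lcδ_apply, hy]
    exact stage_powQuotMap_apply J (i + 1) hs _ w
  · rintro ⟨y, rfl⟩
    obtain ⟨t, w, rfl⟩ := exists_stage_eq J i _ y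
    rw [stage_lcδ_apply, map_stage_apply, (ext_map_f_apply_eq_zero_iff _ hS i _).2 ⟨w, rfl⟩,
      map_zero]

lemma lc_map_g_apply_eq_zero_iff (hS : S.ShortExact) (i : ℕ) (z : (localCohomology J i).obj S.X₂) :
    (localCohomology J i).map S.g z = 0 ↔ ∃ y, (localCohomology J i).map S.f y = z := by
  constructor
  · intro h
    obtain ⟨t, w, rfl⟩ := exists_stage_eq J i _ z
    rw [map_stage_apply] at h
    obtain ⟨s, hs, h0⟩ := exists_le_of_stage_eq_zero J _ _ _ _ h
    have h1 := ConcreteCategory.congr_hom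
      (((Ext R (ModuleCat R) i).map (powQuotMap J hs).op).naturality S.g) w
    obtain ⟨y, hy⟩ := (ext_map_g_apply_eq_zero_iff _ hS i _).1 (h1.symm.trans h0)
    refine ⟨stage J i s _ y, ?_⟩
    rw [map_stage_apply, hy]
    exact stage_powQuotMap_apply J i hs _ w
  · rintro ⟨y, rfl⟩
    obtain ⟨t, w, rfl⟩ := exists_stage_eq J i _ y
    rw [map_stage_apply, map_stage_apply, (ext_map_g_apply_eq_zero_iff _ hS i _).2 ⟨w, rfl⟩,
      map_zero]

lemma lc_zero_map_f_injective (hS : S.ShortExact) (z : (localCohomology J 0).obj S.X₁)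
    (hz : (localCohomology J 0).map S.f z = 0) : z = 0 := by
  obtain ⟨t, w, rfl⟩ := exists_stage_eq J 0 _ z
  rw [map_stage_apply] at hz
  obtain ⟨s, hs, h0⟩ := exists_le_of_stage_eq_zero J _ _ _ _ hz
  have h1 := ConcreteCategory.congr_hom
    (((Ext R (ModuleCat R) 0).map (powQuotMap J hs).op).naturality S.f) w
  have h2 := congrArg extZeroHom (h1.symm.trans h0)
  have h3 := (extZeroHom_map S.f (((Ext R (ModuleCat R) 0).map
    (powQuotMap J hs).op).app S.X₁ w)).symm.trans (h2.trans extZeroHom_zero)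
  have := hS.mono_f
  have h4 := extZeroHom_injective ((zero_of_comp_mono _ h3).trans extZeroHom_zero.symm)
  rw [← stage_powQuotMap_apply J 0 hs, h4, map_zero]

lemma lc_map_smul_apply (i : ℕ) (M : ModuleCat.{0} R) (r : R) (z : (localCohomology J i).obj M) :
    (localCohomology J i).map (r • 𝟙 M) z = r • z := by
  obtain ⟨t, w, rfl⟩ := exists_stage_eq J i _ z
  rw [map_stage_apply, ext_map_smul_apply, map_smul]

lemma stage_smul_eq_zero (i t : ℕ) (M : ModuleCat.{0} R) {r : R} (hr : r ∈ J ^ t)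
    (w : ((Ext R (ModuleCat R) i).obj (.op (powQuot J t))).obj M) :
    r • stage J i t M w = 0 := by
  rw [← map_smul, ext_smul_eq_zero _ _ r _ i w, map_zero]
  intro x
  obtain ⟨x, rfl⟩ := Ideal.Quotient.mk_surjective x
  change Ideal.Quotient.mk _ (r * x) = 0
  exact Ideal.Quotient.eq_zero_iff_mem.2 (Ideal.mul_mem_right _ _ hr)

lemma lc_torsion (i : ℕ) (M : ModuleCat.{0} R) (z : (localCohomology J i).obj M) :
    ∃ t, ∀ r ∈ J ^ t, r • z = 0 := by
  obtain ⟨t, w, rfl⟩ := exists_stage_eq J i _ z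
  exact ⟨t, fun r hr => stage_smul_eq_zero J i t M hr w⟩

end LocalCohomologySequence

section LocalCohomologyModules

variable {R : Type} [CommRing R] (J : Ideal R)

/-- `r` annihilates the `i`-th local cohomology of `M`. -/
def LCKilledBy (i : ℕ) (M : Type) [AddCommGroup M] [Module R M] (r : R) : Prop :=
  ∀ z : localCoh J i M, r • z = 0

/-- The `i`-th local cohomology of `M` is the image of `Ext^i(R/J, M)`. -/
def LCStageOne (i : ℕ) (M : Type) [AddCommGroup M] [Module R M] : Prop :=
  Function.Surjective (extToLocalCoh J i (ModuleCat.of R M))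

variable {M₁ M₂ M₃ : Type} [AddCommGroup M₁] [AddCommGroup M₂] [AddCommGroup M₃]
  [Module R M₁] [Module R M₂] [Module R M₃]

lemma isZero_localCoh_iff (i : ℕ) :
    IsZero (localCoh J i M₁) ↔ ∀ z : localCoh J i M₁, z = 0 := by
  rw [ModuleCat.isZero_iff_subsingleton, subsingleton_iff_forall_eq 0]

/-- If multiplication by `u` on `M₁` factors through `M₂` and `v` kills the local cohomology of
`M₂`, then `u * v` kills that of `M₁`. -/
lemma LCKilledBy.of_factor {i : ℕ} (f : M₁ →ₗ[R] M₂) (g : M₂ →ₗ[R] M₁) (u v : R)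
    (hfg : ∀ x, g (f x) = u • x) (h : LCKilledBy J i M₂ v) : LCKilledBy J i M₁ (u * v) := by
  intro z
  have e : ModuleCat.ofHom f ≫ ModuleCat.ofHom g = u • 𝟙 (ModuleCat.of R M₁) := by
    ext x; exact hfg x
  have h1 := lc_map_smul_apply J i (ModuleCat.of R M₁) u z
  rw [← e] at h1
  have h2 : (localCohomology J i).map (ModuleCat.ofHom f ≫ ModuleCat.ofHom g) z =
    (localCohomology J i).map (ModuleCat.ofHom g)
      ((localCohomology J i).map (ModuleCat.ofHom f) z) := by
    rw [Functor.map_comp]; rfl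
  have h3 : v • (localCohomology J i).map (ModuleCat.ofHom f) z = 0 := h _
  rw [mul_comm, mul_smul]
  refine (congrArg (v • ·) (h1.symm.trans h2)).trans ?_
  refine (map_smul ((localCohomology J i).map (ModuleCat.ofHom g)).hom v _).symm.trans ?_
  exact (congrArg _ h3).trans (map_zero _)

variable (f : M₁ →ₗ[R] M₂) (g : M₂ →ₗ[R] M₃)

/-- A sequence of two linear maps that is short exact. -/
structure IsSES : Prop where
  inj : Function.Injective f
  exact : Function.Exact f g
  surj : Function.Surjective g

variable {f g}

lemma IsSES.shortExact (h : IsSES f g) :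
    (ShortComplex.mk (ModuleCat.ofHom f) (ModuleCat.ofHom g)
      (by ext x; exact h.exact.apply_apply_eq_zero x)).ShortExact :=
  ModuleCat.shortComplex_shortExact _ h.exact h.inj h.surj

lemma IsSES.isZero_middle (h : IsSES f g) {i : ℕ} (h₁ : IsZero (localCoh J i M₁))
    (h₃ : IsZero (localCoh J i M₃)) : IsZero (localCoh J i M₂) := by
  rw [isZero_localCoh_iff] at *
  intro z
  obtain ⟨y, hy⟩ := (lc_map_g_apply_eq_zero_iff J h.shortExact i z).1 (h₃ _)
  rw [← hy, h₁ y]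
  exact map_zero _

lemma IsSES.isZero_left (h : IsSES f g) {i : ℕ} (h₂ : IsZero (localCoh J (i + 1) M₂))
    (h₃ : IsZero (localCoh J i M₃)) : IsZero (localCoh J (i + 1) M₁) := by
  rw [isZero_localCoh_iff] at *
  intro z
  obtain ⟨y, hy⟩ := (lc_map_f_apply_eq_zero_iff J h.shortExact i z).1 (h₂ _)
  rw [← hy, h₃ y]
  exact map_zero _

lemma IsSES.isZero_left_zero (h : IsSES f g) (h₂ : IsZero (localCoh J 0 M₂)) :
    IsZero (localCoh J 0 M₁) := by
  rw [isZero_localCoh_iff] at *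
  exact fun z => lc_zero_map_f_injective J h.shortExact z (h₂ _)

lemma IsSES.killedBy_right (h : IsSES f g) {i : ℕ} {u : R} (h₂ : IsZero (localCoh J i M₂))
    (h₁ : LCKilledBy J (i + 1) M₁ u) : LCKilledBy J i M₃ u := by
  intro z
  rw [isZero_localCoh_iff] at h₂
  obtain ⟨y, hy⟩ := (lcδ_apply_eq_zero_iff J h.shortExact i (u • z)).1
    ((map_smul (lcδ J h.shortExact i).hom u z).trans (h₁ _))
  refine hy.symm.trans ?_
  rw [h₂ y]
  exact map_zero _

/-- An injection on local cohomology of multiplication by `r`, coming from the sequence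
`0 → M₁ → M₁ → M₃ → 0`. -/
lemma IsSES.isZero_of_smul {f : M₁ →ₗ[R] M₁} {g : M₁ →ₗ[R] M₃} (h : IsSES f g) {r : R}
    (hf : ∀ x, f x = r • x) (hr : r ∈ J) {i : ℕ}
    (h₃ : ∀ j, j + 1 = i → IsZero (localCoh J j M₃)) : IsZero (localCoh J i M₁) := by
  have hinj : ∀ z : localCoh J i M₁, r • z = 0 → z = 0 := by
    intro z hz
    have e : r • 𝟙 (ModuleCat.of R M₁) = ModuleCat.ofHom f := by
      ext x; exact (hf x).symm
    have hz' : (localCohomology J i).map (ModuleCat.ofHom f) z = 0 := by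
      rw [← e]; exact (lc_map_smul_apply J i (ModuleCat.of R M₁) r z).trans hz
    cases i with
    | zero => exact lc_zero_map_f_injective J h.shortExact z hz'
    | succ i =>
      obtain ⟨y, hy⟩ := (lc_map_f_apply_eq_zero_iff J h.shortExact i z).1 hz'
      rw [← hy, (isZero_localCoh_iff J i).1 (h₃ i rfl) y]
      exact map_zero _
  rw [isZero_localCoh_iff]
  intro z
  obtain ⟨t, ht⟩ := lc_torsion J i (ModuleCat.of R M₁) z
  have : (r ^ t) • (show localCoh J i M₁ from z) = 0 := ht (r ^ t) (Ideal.pow_mem_pow hr t)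
  clear ht
  induction t with
  | zero => simpa using this
  | succ t ih =>
    rw [pow_succ', mul_smul] at this
    exact ih (hinj _ this)

lemma isSES_prod : IsSES (LinearMap.inl R M₁ M₂) (LinearMap.snd R M₁ M₂) :=
  ⟨LinearMap.inl_injective, .inl_snd, LinearMap.snd_surjective⟩

lemma IsSES.stageOne_left (h : IsSES f g) {i : ℕ} (h₂ : IsZero (localCoh J (i + 1) M₂))
    (h₃ : LCStageOne J i M₃) : LCStageOne J (i + 1) M₁ := by
  intro z
  rw [isZero_localCoh_iff] at h₂
  obtain ⟨y, hy⟩ := (lc_map_f_apply_eq_zero_iff J h.shortExact i z).1 (h₂ _)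
  obtain ⟨w, rfl⟩ := h₃ y
  refine ⟨extδ (powQuot J 1) h.shortExact i w, hy ▸ ?_⟩
  exact (stage_lcδ_apply J h.shortExact i 1 w).symm

lemma IsSES.isFiniteLength_left (h : IsSES f g) {i : ℕ} (h₂ : IsZero (localCoh J (i + 1) M₂))
    (h₃ : IsFiniteLength R (localCoh J i M₃)) : IsFiniteLength R (localCoh J (i + 1) M₁) := by
  rw [isZero_localCoh_iff] at h₂
  refine h₃.of_surjective (f := (lcδ J h.shortExact i).hom) fun z => ?_
  exact (lc_map_f_apply_eq_zero_iff J h.shortExact i z).1 (h₂ _)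

lemma stageOne_of_isZero {i : ℕ} (h : IsZero (localCoh J i M₁)) : LCStageOne J i M₁ :=
  fun z => ⟨0, (map_zero _).trans ((isZero_localCoh_iff J i).1 h z).symm⟩

lemma isFiniteLength_of_isZero {i : ℕ} (h : IsZero (localCoh J i M₁)) :
    IsFiniteLength R (localCoh J i M₁) := by
  have := ModuleCat.subsingleton_of_isZero h
  exact .of_subsingleton

/-- `H⁰` of a module killed by a power of `J` contains the whole module. -/
lemma smul_eq_zero_of_lcKilledBy {t : ℕ} (hM : ∀ r ∈ J ^ t, ∀ x : M₁, r • x = 0) {u : R}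
    (h : LCKilledBy J 0 M₁ u) (x : M₁) : u • x = 0 := by
  obtain ⟨w, hw⟩ := extZeroHom_surjective (X := powQuot J t) (M := ModuleCat.of R M₁)
    (ModuleCat.ofHom (Submodule.liftQ (J ^ t) (LinearMap.toSpanSingleton R M₁ x)
      (fun r hr => hM r hr x)))
  have h0 : stage J 0 t (ModuleCat.of R M₁) (u • w) = 0 :=
    (map_smul (stage J 0 t (ModuleCat.of R M₁)).hom u w).trans (h _)
  obtain ⟨s, hs, h1⟩ := exists_le_of_stage_eq_zero J 0 t _ _ h0
  have h2 := (extZeroHom_map_op (powQuotMap J hs) (u • w)).symm.trans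
    ((congrArg extZeroHom h1).trans extZeroHom_zero)
  have h3 := ConcreteCategory.congr_hom h2 (Ideal.Quotient.mk (J ^ s) (1 : R))
  rw [extZeroHom_smul, hw] at h3
  have h4 : u • ((1 : R) • x) = 0 := h3
  rwa [one_smul] at h4

end LocalCohomologyModules

section Torsion

variable {R : Type} [CommRing R] (J : Ideal R)

lemma ext_succ_eq_zero_of_injective (X E : ModuleCat.{0} R) [Injective E] (i : ℕ)
    (z : ((Ext R (ModuleCat R) (i + 1)).obj (.op X)).obj E) : z = 0 := by
  let P := projectiveResolution X
  have hK : (P.complex.linearYonedaObj R E).ExactAt (i + 1) := by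
    rw [HomologicalComplex.exactAt_iff' _ i (i + 1) (i + 2) (by simp) (by simp),
      ShortComplex.moduleCat_exact_iff]
    intro x hx
    have hx' : P.complex.d (i + 2) (i + 1) ≫ (show P.complex.X (i + 1) ⟶ E from x) = 0 := hx
    exact ⟨(P.exact_succ i).descToInjective _ hx', (P.exact_succ i).comp_descToInjective _ hx'⟩
  apply hom_injective_of_iso (P.isoExt (i + 1) E)
  have := ModuleCat.subsingleton_of_isZero hK.isZero_homology
  exact Subsingleton.elim _ _

lemma isZero_localCoh_succ_of_injective (E : Type) [AddCommGroup E] [Module R E]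
    [Module.Injective R E] (i : ℕ) : IsZero (localCoh J (i + 1) E) := by
  have : Injective (ModuleCat.of R E) := Module.injective_object_of_injective_module R E
  rw [isZero_localCoh_iff]
  intro z
  obtain ⟨t, w, rfl⟩ := exists_stage_eq J (i + 1) _ z
  rw [ext_succ_eq_zero_of_injective _ _ i w]
  exact map_zero _

/-- The submodule of elements killed by a power of `J`. -/
def powTorsion (M : Type) [AddCommGroup M] [Module R M] : Submodule R M where
  carrier := {x | ∃ t, ∀ r ∈ J ^ t, r • x = 0}
  zero_mem' := ⟨0, fun r _ => smul_zero r⟩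
  add_mem' := by
    rintro x y ⟨s, hs⟩ ⟨t, ht⟩
    refine ⟨s + t, fun r hr => ?_⟩
    rw [smul_add, hs r (Ideal.pow_le_pow_right (by omega) hr),
      ht r (Ideal.pow_le_pow_right (by omega) hr), add_zero]
  smul_mem' := by
    rintro a x ⟨t, ht⟩
    exact ⟨t, fun r hr => by rw [smul_comm, ht r hr, smul_zero]⟩

lemma exists_pow_smul_eq_zero_of_fg {M N : Type} [AddCommGroup M] [Module R M] [AddCommGroup N]
    [Module R N] [Module.Finite R N] (g : N →ₗ[R] M)
    (hM : ∀ x, ∃ t, ∀ r ∈ J ^ t, r • g x = 0) :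
    ∃ t, ∀ r ∈ J ^ t, ∀ x, r • g x = 0 := by
  obtain ⟨s, hs⟩ := Module.finite_def.1 ‹Module.Finite R N›
  choose τ hτ using hM
  refine ⟨s.sup τ, fun r hr x => ?_⟩
  have hx : x ∈ Submodule.span R (s : Set N) := hs ▸ Submodule.mem_top
  induction hx using Submodule.span_induction with
  | mem y hy => exact hτ y r (Ideal.pow_le_pow_right (Finset.le_sup hy) hr)
  | zero => simp
  | add y z _ _ hy hz => rw [map_add, smul_add, hy, hz, add_zero]
  | smul a y _ hy => rw [map_smul, smul_comm, hy, smul_zero]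

lemma powTorsion_injective [IsNoetherianRing R] (E : Type) [AddCommGroup E] [Module R E]
    [Module.Injective R E] : Module.Injective R (powTorsion J E) := by
  refine Module.Baer.injective fun I g => ?_
  obtain ⟨t, ht⟩ := exists_pow_smul_eq_zero_of_fg J ((powTorsion J E).subtype ∘ₗ g)
    (fun x => (g x).2)
  obtain ⟨c, hc⟩ := Ideal.exists_pow_inf_eq_pow_smul J I
  have hAR := hc (c + t) (by omega)
  rw [Nat.add_sub_cancel_left] at hAR
  let φ : I →ₗ[R] R ⧸ J ^ (c + t) := (J ^ (c + t)).mkQ ∘ₗ I.subtype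
  have hker : LinearMap.ker φ ≤ LinearMap.ker ((powTorsion J E).subtype ∘ₗ g) := by
    rintro ⟨x, hxI⟩ hx
    have hxJ : x ∈ J ^ (c + t) := by
      simpa [φ, Ideal.Quotient.eq_zero_iff_mem] using hx
    have hx2 : x ∈ J ^ t • (J ^ c • (⊤ : Submodule R R) ⊓ I) :=
      hAR ▸ ⟨by simpa using hxJ, hxI⟩
    have key : ∀ y ∈ J ^ t • (J ^ c • (⊤ : Submodule R R) ⊓ I), ∃ h : y ∈ I,
        (powTorsion J E).subtype (g ⟨y, h⟩) = 0 := by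
      intro y hy
      induction hy using Submodule.smul_induction_on' with
      | smul r hr n hn =>
        refine ⟨I.mul_mem_left r hn.2, ?_⟩
        exact (congrArg (fun v => (powTorsion J E).subtype v)
          (map_smul g r ⟨n, hn.2⟩)).trans (ht r hr ⟨n, hn.2⟩)
      | add a _ b _ ha hb =>
        obtain ⟨ha, ha'⟩ := ha
        obtain ⟨hb, hb'⟩ := hb
        refine ⟨I.add_mem ha hb, ?_⟩
        have : g ⟨a + b, I.add_mem ha hb⟩ = g ⟨a, ha⟩ + g ⟨b, hb⟩ := map_add g ⟨a, ha⟩ ⟨b, hb⟩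
        rw [this, map_add, ha', hb', add_zero]
    exact (key x hx2).2
  obtain ⟨h, hh⟩ := Module.Injective.out (Q := E) ((LinearMap.ker φ).liftQ φ le_rfl)
    (LinearMap.ker_eq_bot.1 (Submodule.ker_liftQ_eq_bot _ _ _ le_rfl))
    ((LinearMap.ker φ).liftQ ((powTorsion J E).subtype ∘ₗ g) hker)
  refine ⟨LinearMap.codRestrict (powTorsion J E) (h ∘ₗ (J ^ (c + t)).mkQ)
    fun x => ⟨c + t, fun r hr => ?_⟩, fun x hx => ?_⟩
  · have : Ideal.Quotient.mk (J ^ (c + t)) (r * x) = 0 :=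
      Ideal.Quotient.eq_zero_iff_mem.2 (Ideal.mul_mem_right _ _ hr)
    exact (map_smul h r _).symm.trans ((congrArg h this).trans (map_zero h))
  · ext
    exact hh (Submodule.Quotient.mk ⟨x, hx⟩)

/-- Lifting elements of zeroth local cohomology along a surjection of torsion modules. -/
lemma lc_zero_map_surjective {M N : Type} [AddCommGroup M] [Module R M] [AddCommGroup N]
    [Module R N] (g : M →ₗ[R] N) (hg : Function.Surjective g)
    (hM : ∀ x : M, ∃ t, ∀ r ∈ J ^ t, r • x = 0) (y : (localCohomology J 0).obj (.of R N)) :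
    ∃ z, (localCohomology J 0).map (ModuleCat.ofHom g) z = y := by
  obtain ⟨t, w, rfl⟩ := exists_stage_eq J 0 _ y
  obtain ⟨e, he⟩ := hg (extZeroHom w (Ideal.Quotient.mk (J ^ t) 1))
  obtain ⟨s', hs'⟩ := hM e
  let s := s' + t
  have hs : ∀ r ∈ J ^ s, r • e = 0 := fun r hr => hs' r (Ideal.pow_le_pow_right (by omega) hr)
  have hts : t ≤ s := by omega
  obtain ⟨w', hw'⟩ := extZeroHom_surjective (X := powQuot J s) (M := ModuleCat.of R M)
    (ModuleCat.ofHom (Submodule.liftQ (J ^ s) (LinearMap.toSpanSingleton R M e)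
      (fun r hr => hs r hr)))
  refine ⟨stage J 0 s _ w', ?_⟩
  rw [map_stage_apply, ← stage_powQuotMap_apply J 0 hts]
  congr 1
  apply extZeroHom_injective
  rw [extZeroHom_map, hw']
  refine Eq.trans ?_ (extZeroHom_map_op (powQuotMap J hts) w).symm
  refine ModuleCat.hom_ext (LinearMap.ext fun x => ?_)
  obtain ⟨x, rfl⟩ := Ideal.Quotient.mk_surjective x
  change g (x • e) = extZeroHom w (Ideal.Quotient.mk (J ^ t) x)
  rw [map_smul, he]
  refine (map_smul (extZeroHom w).hom x _).symm.trans ?_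
  congr 1
  change Ideal.Quotient.mk (J ^ t) (x * 1) = _
  rw [mul_one]

lemma exists_injective_powTorsion_embedding [IsNoetherianRing R] (M : Type) [AddCommGroup M]
    [Module R M] (hM : ∀ x : M, ∃ t, ∀ r ∈ J ^ t, r • x = 0) :
    ∃ (E : ModuleCat.{0} R) (_ : Module.Injective R E) (f : M →ₗ[R] E), Function.Injective f ∧
      ∀ x : E, ∃ t, ∀ r ∈ J ^ t, r • x = 0 := by
  let E := Injective.under (ModuleCat.of R M)
  have hE : Injective (ModuleCat.of R E) :=
    inferInstanceAs (Injective (Injective.under (ModuleCat.of R M)))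
  have : Module.Injective R E := Module.injective_module_of_injective_object R E
  have hι : Function.Injective (Injective.ι (ModuleCat.of R M)) :=
    (ModuleCat.mono_iff_injective _).1 inferInstance
  refine ⟨.of R (powTorsion J E), powTorsion_injective J E,
    LinearMap.codRestrict _ (Injective.ι (ModuleCat.of R M)).hom fun x => ?_, fun x y h => ?_,
    fun x => ?_⟩
  · obtain ⟨t, ht⟩ := hM x
    refine ⟨t, fun r hr => ?_⟩
    exact (map_smul (Injective.ι (ModuleCat.of R M)).hom r x).symm.trans
      ((congrArg _ (ht r hr)).trans (map_zero _))
  · exact hι (congrArg Subtype.val h)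
  · obtain ⟨t, ht⟩ := x.2
    exact ⟨t, fun r hr => Subtype.ext (ht r hr)⟩

/-- Modules in which every element is killed by a power of `J` have no higher local cohomology. -/
lemma isZero_localCoh_succ_of_torsion [IsNoetherianRing R] (i : ℕ) (M : Type) [AddCommGroup M]
    [Module R M] (hM : ∀ x : M, ∃ t, ∀ r ∈ J ^ t, r • x = 0) :
    IsZero (localCoh J (i + 1) M) := by
  induction i generalizing M with
  | zero =>
    obtain ⟨E, _, f, hf, hE⟩ := exists_injective_powTorsion_embedding J M hM
    have hses : IsSES f (LinearMap.range f).mkQ :=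
      ⟨hf, LinearMap.exact_iff.2 (by simp), Submodule.mkQ_surjective _⟩
    have h₂ := (isZero_localCoh_iff J 1).1 (isZero_localCoh_succ_of_injective J E 0)
    rw [isZero_localCoh_iff]
    intro z
    obtain ⟨y, rfl⟩ := (lc_map_f_apply_eq_zero_iff J hses.shortExact 0 z).1 (h₂ _)
    exact (lcδ_apply_eq_zero_iff J hses.shortExact 0 y).2
      (lc_zero_map_surjective J _ (Submodule.mkQ_surjective _) hE y)
  | succ i ih =>
    obtain ⟨E, _, f, hf, hE⟩ := exists_injective_powTorsion_embedding J M hM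
    have hses : IsSES f (LinearMap.range f).mkQ :=
      ⟨hf, LinearMap.exact_iff.2 (by simp), Submodule.mkQ_surjective _⟩
    refine hses.isZero_left J (isZero_localCoh_succ_of_injective J E (i + 1)) (ih _ fun x => ?_)
    obtain ⟨x, rfl⟩ := Submodule.mkQ_surjective _ x
    obtain ⟨t, ht⟩ := hE x
    exact ⟨t, fun r hr => by rw [← map_smul, ht r hr, map_zero]⟩

/-- The zeroth local cohomology of `R / J` is generated by the class of the identity. -/
lemma exists_stage_generator :
    ∃ c : ((Ext R (ModuleCat R) 0).obj (.op (powQuot J 1))).obj (ModuleCat.of R (R ⧸ J)),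
      ∀ z : localCoh J 0 (R ⧸ J), ∃ r : R, r • stage J 0 1 _ c = z := by
  obtain ⟨c, hc⟩ := extZeroHom_surjective (X := powQuot J 1) (M := ModuleCat.of R (R ⧸ J))
    (ModuleCat.ofHom (Submodule.liftQ (J ^ 1) J.mkQ (by rw [pow_one, Submodule.ker_mkQ])))
  refine ⟨c, fun z => ?_⟩
  obtain ⟨t, ht, w, rfl⟩ := exists_stage_eq_of_le J 0 1 _ z
  obtain ⟨r, hr⟩ := Ideal.Quotient.mk_surjective (extZeroHom w (Ideal.Quotient.mk (J ^ t) 1))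
  refine ⟨r, ?_⟩
  refine (map_smul (stage J 0 1 _).hom r c).symm.trans ?_
  refine (stage_powQuotMap_apply J 0 ht _ (r • c)).symm.trans ?_
  congr 1
  apply extZeroHom_injective
  refine (extZeroHom_map_op (powQuotMap J ht) (r • c)).trans ?_
  rw [extZeroHom_smul, hc]
  refine ModuleCat.hom_ext (LinearMap.ext fun x => ?_)
  obtain ⟨x, rfl⟩ := Ideal.Quotient.mk_surjective x
  have h1 : extZeroHom w (Ideal.Quotient.mk (J ^ t) x) =
      x • extZeroHom w (Ideal.Quotient.mk (J ^ t) 1) := by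
    refine Eq.trans (congrArg _ ?_) (map_smul (extZeroHom w).hom x _)
    change _ = Ideal.Quotient.mk (J ^ t) (x * 1)
    rw [mul_one]
  refine Eq.trans ?_ h1.symm
  rw [← hr]
  change Ideal.Quotient.mk J (r * x) = Ideal.Quotient.mk J (x * r)
  rw [mul_comm]

lemma stageOne_zero_quotient : LCStageOne J 0 (R ⧸ J) := by
  obtain ⟨c, hc⟩ := exists_stage_generator J
  intro z
  obtain ⟨r, rfl⟩ := hc z
  exact ⟨r • c, map_smul (stage J 0 1 _).hom r c⟩

lemma isFiniteLength_zero_quotient [J.IsMaximal] : IsFiniteLength R (localCoh J 0 (R ⧸ J)) := by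
  obtain ⟨c, hc⟩ := exists_stage_generator J
  have hs : IsSimpleModule R (R ⧸ J) := isSimpleModule_iff_isCoatom.2 (Ideal.isMaximal_def.1 ‹_›)
  have hl : IsFiniteLength R (R ⧸ J) :=
    isFiniteLength_iff_isNoetherian_isArtinian.2 ⟨inferInstance, inferInstance⟩
  refine hl.of_surjective (f := Submodule.liftQ J (LinearMap.toSpanSingleton R
    (localCoh J 0 (R ⧸ J)) (stage J 0 1 _ c)) fun r hr => ?_) fun z => ?_
  · exact stage_smul_eq_zero J 0 1 _ (by rwa [pow_one]) c
  · obtain ⟨r, hr⟩ := hc z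
    exact ⟨Ideal.Quotient.mk J r, hr⟩

/-- Below the dimension, every element of `J` acts nilpotently on local cohomology. -/
def HasNilpotentLC (I : Ideal R) : Prop :=
  ∀ i : ℕ, (i : WithBot ℕ∞) < ringKrullDim (R ⧸ I) → ∀ u ∈ J, ∃ N,
    LCKilledBy J i (R ⧸ I) (u ^ N)

lemma IsBuchsbaumIdeal.hasNilpotentLC {I : Ideal R} (h : IsBuchsbaumIdeal J I) :
    HasNilpotentLC J I := by
  refine fun i hi u hu => ⟨1, fun z => ?_⟩
  obtain ⟨w, rfl⟩ := h i hi z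
  exact stage_smul_eq_zero J i 1 _ (Ideal.pow_mem_pow hu 1) w

lemma IsGCMIdeal.hasNilpotentLC {I : Ideal R} (h : IsGCMIdeal J I) :
    HasNilpotentLC J I := by
  intro i hi u hu
  have := (isFiniteLength_iff_isNoetherian_isArtinian.1 (h i hi)).1
  obtain ⟨t, ht⟩ := exists_pow_smul_eq_zero_of_fg J
    (LinearMap.id : localCoh J i (R ⧸ I) →ₗ[R] _) (lc_torsion J i _)
  exact ⟨t, ht _ (Ideal.pow_mem_pow hu t)⟩

end Torsion

section MonomialIdeals

variable {R : Type} [CommRing R]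

/-- The Mayer-Vietoris sequence `0 → R/(I ⊓ K) → R/I × R/K → R/(I ⊔ K) → 0`. -/
lemma isSES_mayerVietoris (I K L N : Ideal R) (hL : L = I ⊓ K) (hN : N = I ⊔ K) :
    ∃ (f : (R ⧸ L) →ₗ[R] (R ⧸ I) × (R ⧸ K)) (g : (R ⧸ I) × (R ⧸ K) →ₗ[R] (R ⧸ N)),
      IsSES f g := by
  subst hL hN
  refine ⟨(Submodule.factor inf_le_left).prod (Submodule.factor inf_le_right),
    (Submodule.factor le_sup_left).coprod (-Submodule.factor le_sup_right), ?_, ?_, ?_⟩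
  · rw [← LinearMap.ker_eq_bot, LinearMap.ker_eq_bot']
    intro x hx
    obtain ⟨x, rfl⟩ := Ideal.Quotient.mk_surjective x
    have h1 : Ideal.Quotient.mk I x = 0 := congrArg Prod.fst hx
    have h2 : Ideal.Quotient.mk K x = 0 := congrArg Prod.snd hx
    rw [Ideal.Quotient.eq_zero_iff_mem] at *
    exact ⟨h1, h2⟩
  · rintro ⟨x, y⟩
    obtain ⟨x, rfl⟩ := Ideal.Quotient.mk_surjective x
    obtain ⟨y, rfl⟩ := Ideal.Quotient.mk_surjective y
    have e : ((Submodule.factor le_sup_left).coprod (-Submodule.factor le_sup_right))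
        (Ideal.Quotient.mk I x, Ideal.Quotient.mk K y) = Ideal.Quotient.mk (I ⊔ K) (x - y) := by
      rw [map_sub, sub_eq_add_neg]; rfl
    rw [e, Ideal.Quotient.eq_zero_iff_mem, Submodule.mem_sup]
    constructor
    · rintro ⟨p, hp, q, hq, hpq⟩
      refine ⟨Ideal.Quotient.mk _ (x - p), Prod.ext ?_ ?_⟩
      · exact Ideal.Quotient.eq.2 (by simpa using hp)
      · refine Ideal.Quotient.eq.2 ?_
        have : x - p - y = q := by linear_combination - hpq
        exact this ▸ hq
    · rintro ⟨z, hz⟩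
      obtain ⟨z, rfl⟩ := Ideal.Quotient.mk_surjective z
      have h1 : Ideal.Quotient.mk I z = Ideal.Quotient.mk I x := congrArg Prod.fst hz
      have h2 : Ideal.Quotient.mk K z = Ideal.Quotient.mk K y := congrArg Prod.snd hz
      rw [Ideal.Quotient.eq] at h1 h2
      exact ⟨x - z, by simpa using I.neg_mem h1, z - y, h2, by ring⟩
  · intro z
    obtain ⟨z, rfl⟩ := Ideal.Quotient.mk_surjective z
    refine ⟨(Ideal.Quotient.mk I z, 0), ?_⟩
    rw [LinearMap.coprod_apply, map_zero, add_zero]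
    rfl

/-- The sequence `0 → R/K → R/I → R/L → 0` given by multiplication by `u`, where `K = I : u` and
`L = I + (u)`. -/
lemma isSES_colon (I K L : Ideal R) (u : R) (hK : ∀ r, r ∈ K ↔ u * r ∈ I)
    (hL : ∀ r, r ∈ L ↔ ∃ s, r - u * s ∈ I) :
    ∃ (f : (R ⧸ K) →ₗ[R] (R ⧸ I)) (g : (R ⧸ I) →ₗ[R] (R ⧸ L)), IsSES f g ∧
      (∀ r, f (Ideal.Quotient.mk K r) = Ideal.Quotient.mk I (u * r)) ∧
      ∀ r, g (Ideal.Quotient.mk I r) = Ideal.Quotient.mk L r := by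
  have hIL : I ≤ L := fun r hr => (hL r).2 ⟨0, by simpa using hr⟩
  refine ⟨Submodule.mapQ K I (LinearMap.mulLeft R u) fun r hr => (hK r).1 hr,
    Submodule.factor hIL, ⟨?_, ?_, ?_⟩, fun r => rfl, fun r => rfl⟩
  · rw [← LinearMap.ker_eq_bot, LinearMap.ker_eq_bot']
    intro x hx
    obtain ⟨x, rfl⟩ := Ideal.Quotient.mk_surjective x
    have h1 : Ideal.Quotient.mk I (u * x) = 0 := hx
    rw [Ideal.Quotient.eq_zero_iff_mem] at *
    exact (hK x).2 h1
  · intro y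
    obtain ⟨y, rfl⟩ := Ideal.Quotient.mk_surjective y
    have e : Submodule.factor hIL (Ideal.Quotient.mk I y) = Ideal.Quotient.mk L y := rfl
    rw [e, Ideal.Quotient.eq_zero_iff_mem, hL]
    constructor
    · rintro ⟨s, hs⟩
      exact ⟨Ideal.Quotient.mk K s, (Ideal.Quotient.eq.2 hs).symm⟩
    · rintro ⟨z, hz⟩
      obtain ⟨z, rfl⟩ := Ideal.Quotient.mk_surjective z
      have h1 : Ideal.Quotient.mk I (u * z) = Ideal.Quotient.mk I y := hz
      exact ⟨z, Ideal.Quotient.eq.1 h1.symm⟩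
  · intro z
    obtain ⟨z, rfl⟩ := Ideal.Quotient.mk_surjective z
    exact ⟨Ideal.Quotient.mk I z, rfl⟩

variable {k : Type} [Field k] {V : Type}

variable (k) in
/-- The monomial ideal whose standard monomials are the exponents in `D`. -/
def offIdeal (D : LowerSet (V →₀ ℕ)) : Ideal (MvPolynomial V k) where
  carrier := {f | ∀ d ∈ D, coeff d f = 0}
  zero_mem' := fun d _ => coeff_zero d
  add_mem' := fun hf hg d hd => by rw [coeff_add, hf d hd, hg d hd, add_zero]
  smul_mem' := fun c f hf d hd => by
    classical
    rw [smul_eq_mul, coeff_mul]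
    refine Finset.sum_eq_zero fun p hp => ?_
    rw [hf p.2 (D.lower (by
      rw [← Finset.HasAntidiagonal.mem_antidiagonal.1 hp]; exact le_add_self) hd), mul_zero]

lemma mem_offIdeal {D : LowerSet (V →₀ ℕ)} {f : MvPolynomial V k} :
    f ∈ offIdeal k D ↔ ∀ d ∈ D, coeff d f = 0 := Iff.rfl

lemma offIdeal_antitone {D E : LowerSet (V →₀ ℕ)} (h : D ≤ E) : offIdeal k E ≤ offIdeal k D :=
  fun _ hf d hd => hf d (h hd)

lemma offIdeal_sup (D E : LowerSet (V →₀ ℕ)) :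
    offIdeal k (D ⊔ E) = offIdeal k D ⊓ offIdeal k E := by
  ext f
  simp only [Submodule.mem_inf, mem_offIdeal, LowerSet.mem_sup_iff]
  exact ⟨fun h => ⟨fun d hd => h d (.inl hd), fun d hd => h d (.inr hd)⟩,
    fun h d hd => hd.elim (h.1 d) (h.2 d)⟩

lemma offIdeal_inf (D E : LowerSet (V →₀ ℕ)) :
    offIdeal k (D ⊓ E) = offIdeal k D ⊔ offIdeal k E := by
  classical
  refine le_antisymm (fun f hf => ?_)
    (sup_le (offIdeal_antitone inf_le_left) (offIdeal_antitone inf_le_right))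
  have hc : ∀ (p : (V →₀ ℕ) → Prop) [DecidablePred p] (d : V →₀ ℕ),
      coeff d (∑ e ∈ f.support with p e, monomial e (coeff e f)) =
        if p d then coeff d f else 0 := by
    intro p _ d
    simp only [coeff_sum, coeff_monomial, Finset.sum_ite_eq', Finset.mem_filter, mem_support_iff]
    by_cases h : coeff d f = 0 <;> simp [h]
  refine Submodule.mem_sup.2 ⟨∑ e ∈ f.support with e ∉ D, monomial e (coeff e f), fun d hd => ?_,
    ∑ e ∈ f.support with e ∈ D, monomial e (coeff e f), fun d hd => ?_, ?_⟩
  · rw [hc, if_neg (by simpa using hd)]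
  · rw [hc]
    split_ifs with h
    · exact hf d ⟨h, hd⟩
    · rfl
  · ext d
    rw [coeff_add, hc, hc]
    by_cases h : d ∈ D <;> simp [h]

/-- The colon sequence for a monomial. -/
lemma isSES_offIdeal (D C E : LowerSet (V →₀ ℕ)) (e : V →₀ ℕ) (hC : ∀ d, d ∈ C ↔ e + d ∈ D)
    (hE : ∀ d, d ∈ E ↔ d ∈ D ∧ ¬ e ≤ d) :
    ∃ (f : (MvPolynomial V k ⧸ offIdeal k C) →ₗ[MvPolynomial V k] (MvPolynomial V k ⧸ offIdeal k D))
      (g : (MvPolynomial V k ⧸ offIdeal k D) →ₗ[MvPolynomial V k]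
        (MvPolynomial V k ⧸ offIdeal k E)), IsSES f g ∧
      (∀ r, f (Ideal.Quotient.mk _ r) = Ideal.Quotient.mk _ (monomial e 1 * r)) ∧
      ∀ r, g (Ideal.Quotient.mk _ r) = Ideal.Quotient.mk _ r := by
  refine isSES_colon _ _ _ _ (fun r => ⟨fun h d hd => ?_, fun h d hd => ?_⟩)
    (fun r => ⟨fun h => ⟨divMonomial r e, fun d hd => ?_⟩, fun ⟨s, h⟩ d hd => ?_⟩)
  · rw [coeff_monomial_mul']
    split_ifs with hed
    · rw [one_mul]
      exact h _ ((hC _).2 (by rwa [add_tsub_cancel_of_le hed]))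
    · rfl
  · simpa using h _ ((hC d).1 hd)
  · rw [coeff_sub, coeff_monomial_mul']
    split_ifs with hed
    · rw [one_mul, coeff_divMonomial, add_tsub_cancel_of_le hed, sub_self]
    · rw [sub_zero]
      exact h d ((hE d).2 ⟨hd, hed⟩)
  · obtain ⟨hd, hed⟩ := (hE d).1 hd
    have := h d hd
    rwa [coeff_sub, coeff_monomial_mul', if_neg hed, sub_zero] at this

end MonomialIdeals

section Boxes

open Classical in
/-- Exponents bounded by `c` outside of `F`. -/
def boxLower {V : Type} (F : Finset V) (c : V → ℕ) : LowerSet (V →₀ ℕ) where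
  carrier := {d | ∀ v ∉ F, d v ≤ c v}
  lower' := fun _ _ hab ha v hv => (hab v).trans (ha v hv)

lemma mem_boxLower {V : Type} {F : Finset V} {c : V → ℕ} {d : V →₀ ℕ} :
    d ∈ boxLower F c ↔ ∀ v ∉ F, d v ≤ c v := Iff.rfl

variable {k : Type} [Field k] {V : Type}

lemma X_mem_maxIdeal (v : V) : (X v : MvPolynomial V k) ∈ maxIdeal k V :=
  Ideal.subset_span ⟨v, rfl⟩

open Classical in
lemma isSES_boxLower {F : Finset V} {v : V} (hv : v ∉ F) (c : V → ℕ) (N : ℕ) :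
    ∃ (f : (MvPolynomial V k ⧸ offIdeal k (boxLower (insert v F) c)) →ₗ[MvPolynomial V k]
        (MvPolynomial V k ⧸ offIdeal k (boxLower (insert v F) c)))
      (g : (MvPolynomial V k ⧸ offIdeal k (boxLower (insert v F) c)) →ₗ[MvPolynomial V k]
        (MvPolynomial V k ⧸ offIdeal k (boxLower F (Function.update c v N)))),
      IsSES f g ∧ ∀ x, f x = (X v ^ (N + 1) : MvPolynomial V k) • x := by
  obtain ⟨f, g, h, hf, -⟩ := isSES_offIdeal (k := k) (boxLower (insert v F) c)
    (boxLower (insert v F) c) (boxLower F (Function.update c v N)) (Finsupp.single v (N + 1))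
    (fun d => by
      simp only [mem_boxLower]
      refine forall₂_congr fun w hw => ?_
      have : v ≠ w := fun h => hw (h ▸ Finset.mem_insert_self _ _)
      simp [this])
    (fun d => by
      simp only [mem_boxLower, Finsupp.single_le_iff]
      constructor
      · intro h
        refine ⟨fun w hw => ?_, ?_⟩
        · rw [Finset.mem_insert, not_or] at hw
          simpa [Function.update_of_ne hw.1] using h w hw.2
        · have := h v hv
          rw [Function.update_self] at this
          omega
      · rintro ⟨h1, h2⟩ w hw
        by_cases hwv : w = v
        · subst hwv
          rw [Function.update_self]
          omega
        · rw [Function.update_of_ne hwv]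
          exact h1 w (by simp [hwv, hw]))
  refine ⟨f, g, h, fun x => ?_⟩
  obtain ⟨x, rfl⟩ := Ideal.Quotient.mk_surjective x
  rw [hf, X_pow_eq_monomial]
  rfl

lemma isZero_localCoh_boxLower (F : Finset V) (c : V → ℕ) (i : ℕ) (hi : i < F.card) :
    IsZero (localCoh (maxIdeal k V) i (MvPolynomial V k ⧸ offIdeal k (boxLower F c))) := by
  classical
  induction F using Finset.induction_on generalizing c i with
  | empty => simp at hi
  | insert v F hv ih =>
    obtain ⟨f, g, h, hf⟩ := isSES_boxLower (k := k) hv c 0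
    rw [Finset.card_insert_of_notMem hv] at hi
    exact h.isZero_of_smul _ hf (by simpa using X_mem_maxIdeal v)
      fun j hj => ih _ _ (by omega)

lemma mem_maxIdeal_pow_iff (t : ℕ) (f : MvPolynomial V k) :
    f ∈ maxIdeal k V ^ t ↔ ∀ d, Finsupp.degree d < t → coeff d f = 0 :=
  mem_pow_idealOfVars_iff' t f

lemma smul_eq_zero_of_mem_maxIdeal_pow [Fintype V] (c : V → ℕ) (r : MvPolynomial V k)
    (hr : r ∈ maxIdeal k V ^ (∑ v, c v + 1))
    (x : MvPolynomial V k ⧸ offIdeal k (boxLower ∅ c)) : r • x = 0 := by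
  obtain ⟨x, rfl⟩ := Ideal.Quotient.mk_surjective x
  have : r ∈ offIdeal k (boxLower ∅ c) := fun d hd => by
    refine (mem_maxIdeal_pow_iff _ r).1 hr d ?_
    rw [Finsupp.degree_eq_sum, Nat.lt_succ_iff]
    exact Finset.sum_le_sum fun v _ => hd v (Finset.notMem_empty v)
  exact Ideal.Quotient.eq_zero_iff_mem.2 (Ideal.mul_mem_right x _ this)

open Classical in
/-- The monomial supported on `F`, to the power `N`. -/
def facePow (F : Finset V) (N : ℕ) : V →₀ ℕ := Finsupp.indicator F fun _ _ => N

lemma facePow_apply [DecidableEq V] (F : Finset V) (N : ℕ) (v : V) :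
    facePow F N v = if v ∈ F then N else 0 := by
  unfold facePow
  by_cases h : v ∈ F <;> simp [h, Finsupp.indicator_apply]

lemma monomial_facePow_pow (F : Finset V) (N : ℕ) :
    (monomial (facePow F 1) (1 : k)) ^ N = monomial (facePow F N) 1 := by
  classical
  have : N • facePow F 1 = facePow F N := by
    ext v
    simp [facePow_apply]
  rw [monomial_pow, one_pow, this]

/-- Top local cohomology of a face ring is not killed by a power of the face monomial. -/
lemma not_lcKilledBy_boxLower [Fintype V] (F F₀ : Finset V) (c : V → ℕ) (N : ℕ)
    (hc : ∀ v ∈ F₀, v ∉ F → N ≤ c v) :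
    ¬ LCKilledBy (maxIdeal k V) F.card (MvPolynomial V k ⧸ offIdeal k (boxLower F c))
      (monomial (facePow F₀ N) 1) := by
  classical
  induction F using Finset.induction_on generalizing c with
  | empty =>
    intro h
    have h1 := smul_eq_zero_of_lcKilledBy _ (smul_eq_zero_of_mem_maxIdeal_pow c) h
      (Ideal.Quotient.mk _ 1)
    have h2 : Ideal.Quotient.mk (offIdeal k (boxLower ∅ c))
      (monomial (facePow F₀ N) 1 * 1) = 0 := h1
    rw [mul_one, Ideal.Quotient.eq_zero_iff_mem] at h2
    have := h2 (facePow F₀ N) fun v _ => by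
      rw [facePow_apply]
      split_ifs with hv
      · exact hc v hv (Finset.notMem_empty v)
      · exact Nat.zero_le _
    simp at this
  | insert v F hv ih =>
    intro h
    obtain ⟨f, g, hs, -⟩ := isSES_boxLower (k := k) hv c N
    refine ih (Function.update c v N) (fun w hw hwF => ?_) (hs.killedBy_right _
      (isZero_localCoh_boxLower _ _ _ (by rw [Finset.card_insert_of_notMem hv]; omega))
      (by rwa [Finset.card_insert_of_notMem hv] at h))
    by_cases hwv : w = v
    · subst hwv
      rw [Function.update_self]
    · rw [Function.update_of_ne hwv]
      exact hc w hw (by simp [hwv, hwF])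

lemma offIdeal_boxLower_empty : offIdeal k (boxLower (∅ : Finset V) 0) = maxIdeal k V := by
  ext f
  rw [← pow_one (maxIdeal k V), mem_maxIdeal_pow_iff, mem_offIdeal]
  refine forall_congr' fun d => imp_congr_left ?_
  rw [Nat.lt_one_iff, Finsupp.degree_eq_zero_iff, mem_boxLower, Finsupp.ext_iff]
  simp

instance maxIdeal_isMaximal : (maxIdeal k V).IsMaximal := by
  have : maxIdeal k V = RingHom.ker (constantCoeff (R := k) (σ := V)) := by
    ext f
    rw [← pow_one (maxIdeal k V), mem_maxIdeal_pow_iff, RingHom.mem_ker, constantCoeff_eq]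
    simp [Finsupp.degree_eq_zero_iff]
  rw [this]
  exact RingHom.ker_isMaximal_of_surjective _ fun a => ⟨C a, constantCoeff_C V a⟩

lemma isZero_localCoh_succ_maxIdeal [Finite V] (i : ℕ) :
    IsZero (localCoh (maxIdeal k V) (i + 1) (MvPolynomial V k ⧸ maxIdeal k V)) :=
  isZero_localCoh_succ_of_torsion _ i _ fun x => ⟨1, fun r hr => by
    obtain ⟨x, rfl⟩ := Ideal.Quotient.mk_surjective x
    rw [pow_one] at hr
    exact Ideal.Quotient.eq_zero_iff_mem.2 (Ideal.mul_mem_right x _ hr)⟩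

end Boxes

section Dimension

lemma ringKrullDim_quotient_le_of_forall_or {R : Type} [CommRing R] {I I₁ I₂ : Ideal R}
    (h : ∀ p : Ideal R, p.IsPrime → I ≤ p → I₁ ≤ p ∨ I₂ ≤ p) {b : WithBot ℕ∞}
    (h₁ : ringKrullDim (R ⧸ I₁) ≤ b) (h₂ : ringKrullDim (R ⧸ I₂) ≤ b) :
    ringKrullDim (R ⧸ I) ≤ b := by
  rw [ringKrullDim_quotient] at *
  refine iSup_le fun s => ?_
  have key : ∀ K : Ideal R, K ≤ s.head.1.asIdeal →
      (s.length : WithBot ℕ∞) ≤ Order.krullDim (PrimeSpectrum.zeroLocus (R := R) K) := by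
    intro K hK
    let q : LTSeries (PrimeSpectrum.zeroLocus (R := R) K) :=
      ⟨s.length, fun i => ⟨(s i).1, hK.trans (s.head_le i)⟩, fun i => s.step i⟩
    exact Order.LTSeries.length_le_krullDim q
  rcases h _ s.head.1.2 s.head.2 with hK | hK
  · exact (key _ hK).trans h₁
  · exact (key _ hK).trans h₂

variable {k : Type} [Field k] {V : Type}

lemma ringKrullDim_quotient_le_of_le {R : Type} [CommRing R] {I K : Ideal R} (h : I ≤ K) :
    ringKrullDim (R ⧸ K) ≤ ringKrullDim (R ⧸ I) :=
  ringKrullDim_le_of_surjective (Ideal.Quotient.factor h) (Ideal.Quotient.factor_surjective h)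

lemma ringKrullDim_mvPolynomial_finset (W : Finset V) :
    ringKrullDim (MvPolynomial W k) = W.card := by
  rw [MvPolynomial.ringKrullDim_of_isNoetherianRing, ringKrullDim_eq_zero_of_field, zero_add,
    Nat.card_eq_fintype_card, Fintype.card_coe]

lemma ringKrullDim_boxLower_le (W : Finset V) :
    ringKrullDim (MvPolynomial V k ⧸ offIdeal k (boxLower W 0)) ≤ W.card := by
  classical
  rw [← ringKrullDim_mvPolynomial_finset (k := k) W]
  refine ringKrullDim_le_of_surjective ((Ideal.Quotient.mk (offIdeal k (boxLower W 0))).comp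
    (rename (R := k) (Subtype.val : W → V)).toRingHom) fun z => ?_
  obtain ⟨f, rfl⟩ := Ideal.Quotient.mk_surjective z
  induction f using MvPolynomial.induction_on with
  | C a => exact ⟨C a, by simp⟩
  | add p q hp hq =>
    obtain ⟨p', hp⟩ := hp
    obtain ⟨q', hq⟩ := hq
    exact ⟨p' + q', by rw [map_add, hp, hq, map_add]⟩
  | mul_X p v hp =>
    obtain ⟨p', hp⟩ := hp
    by_cases hv : v ∈ W
    · exact ⟨p' * X ⟨v, hv⟩, by rw [map_mul, hp, map_mul]; simp⟩
    · refine ⟨0, ?_⟩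
      rw [map_zero, map_mul, show Ideal.Quotient.mk (offIdeal k (boxLower W 0)) (X v) = 0 from ?_,
        mul_zero]
      refine Ideal.Quotient.eq_zero_iff_mem.2 ?_
      intro d hd
      rw [coeff_X, if_neg]
      rintro rfl
      simpa using hd v hv

lemma le_ringKrullDim_boxLower [Fintype V] (W : Finset V) :
    (W.card : WithBot ℕ∞) ≤ ringKrullDim (MvPolynomial V k ⧸ offIdeal k (boxLower W 0)) := by
  classical
  rw [← ringKrullDim_mvPolynomial_finset (k := k) W]
  let φ : MvPolynomial V k →ₐ[k] MvPolynomial W k :=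
    aeval fun v => if h : v ∈ W then X ⟨v, h⟩ else 0
  have hφ : Function.Surjective φ := fun f => by
    refine ⟨rename Subtype.val f, ?_⟩
    have : (φ.comp (rename Subtype.val)) = AlgHom.id k (MvPolynomial W k) := by
      ext w
      simp [φ]
    exact DFunLike.congr_fun this f
  have h0 : ∀ f ∈ offIdeal k (boxLower W 0), φ.toRingHom f = 0 := by
    intro f hf
    change aeval _ f = 0
    rw [aeval_def, eval₂_eq']
    refine Finset.sum_eq_zero fun d hd => ?_
    have : ¬ ∀ v ∉ W, d v ≤ 0 := fun h => mem_support_iff.1 hd (hf d h)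
    push Not at this
    obtain ⟨v, hv, hdv⟩ := this
    rw [Finset.prod_eq_zero (Finset.mem_univ v), mul_zero]
    rw [dif_neg hv, zero_pow hdv.ne']
  exact ringKrullDim_le_of_surjective (Ideal.Quotient.lift _ φ.toRingHom h0)
    (Ideal.Quotient.lift_surjective_of_surjective _ h0 hφ)

end Dimension

section IndependentSets

variable {k : Type} [Field k] {V : Type} (G : SimpleGraph V)

/-- Exponents whose support is an independent subset of `W`. -/
def indLower (W : Finset V) : LowerSet (V →₀ ℕ) where
  carrier := {d | d.support ⊆ W ∧ IsIndepSet G d.support}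
  lower' := fun _ _ hab ha => ⟨(Finsupp.support_mono hab).trans ha.1,
    fun u hu v hv => ha.2 u (Finsupp.support_mono hab hu) v (Finsupp.support_mono hab hv)⟩

variable {G}

lemma mem_indLower {W : Finset V} {d : V →₀ ℕ} :
    d ∈ indLower G W ↔ d.support ⊆ W ∧ IsIndepSet G d.support := Iff.rfl

lemma mem_boxLower_zero {F : Finset V} {d : V →₀ ℕ} :
    d ∈ boxLower F 0 ↔ d.support ⊆ F := by
  rw [mem_boxLower]
  refine ⟨fun h v hv => ?_, fun h v hv => ?_⟩
  · by_contra hF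
    exact Finsupp.mem_support_iff.1 hv (Nat.le_zero.1 (h v hF))
  · by_contra hd
    exact hv (h (Finsupp.mem_support_iff.2 (by simpa using hd)))

lemma boxLower_inf [DecidableEq V] (A B : Finset V) :
    boxLower A 0 ⊓ boxLower B 0 = boxLower (A ∩ B) 0 := by
  ext d
  change d ∈ boxLower A 0 ∧ d ∈ boxLower B 0 ↔ d ∈ boxLower (A ∩ B) 0
  simp only [mem_boxLower_zero, Finset.subset_inter_iff]

lemma IsIndepSet.subset {S T : Finset V} (h : IsIndepSet G T) (hST : S ⊆ T) : IsIndepSet G S :=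
  fun u hu v hv => h u (hST hu) v (hST hv)

lemma indLower_eq_boxLower {W : Finset V} (h : IsIndepSet G W) :
    indLower G W = boxLower W 0 := by
  ext d
  exact (mem_indLower.trans ⟨fun hd => hd.1, fun hd => ⟨hd, h.subset hd⟩⟩).trans
    mem_boxLower_zero.symm

lemma support_single_add [DecidableEq V] (y : V) (d : V →₀ ℕ) :
    (Finsupp.single y 1 + d).support = insert y d.support := by
  ext v
  by_cases h : y = v
  · simp [h]
  · simp [Ne.symm h]

lemma support_facePow_add [DecidableEq V] (F : Finset V) (d : V →₀ ℕ) :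
    (facePow F 1 + d).support = F ∪ d.support := by
  ext v
  by_cases h : v ∈ F <;> simp [h, facePow_apply]

open Classical in
/-- The deletion-contraction sequence at a vertex. -/
lemma isSES_indLower {W : Finset V} {y : V} (hy : y ∈ W) :
    ∃ (f : (MvPolynomial V k ⧸ offIdeal k (indLower G (W.filter fun v => ¬ G.Adj y v)))
        →ₗ[MvPolynomial V k] (MvPolynomial V k ⧸ offIdeal k (indLower G W)))
      (g : (MvPolynomial V k ⧸ offIdeal k (indLower G W)) →ₗ[MvPolynomial V k]
        (MvPolynomial V k ⧸ offIdeal k (indLower G (W.erase y)))), IsSES f g ∧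
      (∀ r, f (Ideal.Quotient.mk _ r) =
        Ideal.Quotient.mk _ (monomial (Finsupp.single y 1) 1 * r)) ∧
      ∀ r, g (Ideal.Quotient.mk _ r) = Ideal.Quotient.mk _ r := by
  refine isSES_offIdeal _ _ _ (Finsupp.single y 1) (fun d => ?_) (fun d => ?_)
  · rw [mem_indLower, mem_indLower, support_single_add]
    constructor
    · rintro ⟨h1, h2⟩
      have hyd : ∀ v ∈ d.support, ¬ G.Adj y v := fun v hv => (Finset.mem_filter.1 (h1 hv)).2
      refine ⟨Finset.insert_subset hy (h1.trans (Finset.filter_subset _ _)), fun u hu v hv => ?_⟩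
      rcases Finset.mem_insert.1 hu with rfl | hu'
      · rcases Finset.mem_insert.1 hv with rfl | hv'
        · exact G.loopless.irrefl v
        · exact hyd v hv'
      · rcases Finset.mem_insert.1 hv with rfl | hv'
        · exact fun h => hyd u hu' h.symm
        · exact h2 u hu' v hv'
    · rintro ⟨h1, h2⟩
      rw [Finset.insert_subset_iff] at h1
      refine ⟨fun v hv => Finset.mem_filter.2 ⟨h1.2 hv, ?_⟩,
        h2.subset (Finset.subset_insert _ _)⟩
      exact h2 y (Finset.mem_insert_self _ _) v (Finset.mem_insert_of_mem hv)
  · rw [mem_indLower, mem_indLower, Finsupp.single_le_iff, Finset.subset_erase,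
      Finsupp.notMem_support_iff, Nat.one_le_iff_ne_zero, not_not]
    tauto

/-- If a power of the face monomial kills local cohomology of the whole ring, it kills local
cohomology of the star of the face. -/
lemma LCKilledBy.star {D C : LowerSet (V →₀ ℕ)} {F : Finset V}
    (hC : ∀ d, d ∈ C ↔ facePow F 1 + d ∈ D) {J : Ideal (MvPolynomial V k)} {i N : ℕ}
    (h : LCKilledBy J i (MvPolynomial V k ⧸ offIdeal k D) (monomial (facePow F 1) 1 ^ N)) :
    LCKilledBy J i (MvPolynomial V k ⧸ offIdeal k C) (monomial (facePow F (N + 1)) 1) := by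
  have hCD : C ≤ D := fun d hd => D.lower (by exact le_add_self) ((hC d).1 hd)
  rw [← monomial_facePow_pow, pow_succ']
  refine LCKilledBy.of_factor J (M₂ := MvPolynomial V k ⧸ offIdeal k D)
    (Submodule.mapQ _ _ (LinearMap.mulLeft (MvPolynomial V k) (monomial (facePow F 1) 1))
      fun r hr d hd => ?_) (Submodule.factor (offIdeal_antitone hCD)) _ _ (fun x => ?_) h
  · rw [LinearMap.mulLeft_apply, coeff_monomial_mul']
    split_ifs with hed
    · rw [one_mul]
      exact hr _ ((hC _).2 (by rwa [add_tsub_cancel_of_le hed]))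
    · rfl
  · obtain ⟨x, rfl⟩ := Ideal.Quotient.mk_surjective x
    rfl

end IndependentSets

section Bipartite

open Classical in
/-- The vertices of `W` outside `F` without neighbour in `F`. -/
def linkVertices {V : Type} (G : SimpleGraph V) (W F : Finset V) : Finset V :=
  W.filter fun v => v ∉ F ∧ ∀ u ∈ F, ¬ G.Adj u v

open Classical in
lemma mem_linkVertices {V : Type} {G : SimpleGraph V} {W F : Finset V} {v : V} :
    v ∈ linkVertices G W F ↔ v ∈ W ∧ v ∉ F ∧ ∀ u ∈ F, ¬ G.Adj u v := by
  rw [linkVertices, Finset.mem_filter]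

/-- The graph induced on `R` is complete bipartite with respect to the colour class `P`,
both classes being nonempty. -/
def IsCompleteBipartiteOn {V : Type} (G : SimpleGraph V) (P : V → Prop) (R : Finset V) : Prop :=
  (∃ a ∈ R, P a) ∧ (∃ b ∈ R, ¬ P b) ∧ ∀ a ∈ R, ∀ b ∈ R, P a → ¬ P b → G.Adj a b

/-- No link of an independent subset of `W` is complete bipartite on more than two vertices. -/
def IsThin {V : Type} (G : SimpleGraph V) (P : V → Prop) (W : Finset V) : Prop :=
  ∀ F ⊆ W, IsIndepSet G F → IsCompleteBipartiteOn G P (linkVertices G W F) →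
    (linkVertices G W F).card ≤ 2

open Classical in
/-- The number of vertices of `W` in the second class or isolated in `W`. -/
def bipDim {V : Type} (G : SimpleGraph V) (P : V → Prop) (W : Finset V) : ℕ :=
  (W.filter fun v => P v → ∀ w ∈ W, ¬ G.Adj v w).card

variable {V : Type} {G : SimpleGraph V} {P : V → Prop}

open Classical in
lemma IsThin.exists_pendant (hP : ∀ u v, G.Adj u v → (P u ↔ ¬ P v)) {W : Finset V}
    (hW : IsThin G P W) (hE : ¬ IsIndepSet G W) :
    ∃ x ∈ W, ∃ y ∈ W, P x ∧ G.Adj x y ∧ (∀ v ∈ W, G.Adj x v → v = y) ∧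
      ∀ z ∈ W, G.Adj z y → (∀ v ∈ W, G.Adj z v → v = y) → z = x := by
  have hne : (W.filter fun v => P v ∧ ∃ w ∈ W, G.Adj v w).Nonempty := by
    simp only [IsIndepSet, not_forall, not_not] at hE
    obtain ⟨u, hu, v, hv, huv⟩ := hE
    by_cases h : P u
    · exact ⟨u, Finset.mem_filter.2 ⟨hu, h, v, hv, huv⟩⟩
    · exact ⟨v, Finset.mem_filter.2 ⟨hv, (hP v u huv.symm).2 h, u, hu, huv.symm⟩⟩
  obtain ⟨x, hx, hmin⟩ := Finset.exists_min_image _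
    (fun v => (W.filter fun w => G.Adj v w).card) hne
  obtain ⟨hxW, hxP, y, hyW, hxy⟩ := Finset.mem_filter.1 hx
  set F : Finset V := W.filter fun v =>
    (¬ P v ∧ ¬ G.Adj x v) ∨ (P v ∧ ∀ w ∈ W, ¬ G.Adj v w) with hF
  have hmF : ∀ v, v ∈ F ↔ v ∈ W ∧ ((¬ P v ∧ ¬ G.Adj x v) ∨ (P v ∧ ∀ w ∈ W, ¬ G.Adj v w)) :=
    fun v => Finset.mem_filter
  have hFi : IsIndepSet G F := by
    intro u hu v hv huv
    have h1 := (hmF u).1 hu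
    have h2 := (hmF v).1 hv
    have h3 := hP u v huv
    have h4 := h1.2.elim (fun h => h2.2.elim (fun h' => absurd (h3.2 h'.1) h.1)
      fun h' => h'.2 u h1.1 huv.symm) fun h => h.2 v h2.1 huv
    exact h4
  have hmem : ∀ z ∈ W, G.Adj z y → (∀ v ∈ W, G.Adj z v → G.Adj x v) →
      z ∈ linkVertices G W F := by
    intro z hz hzy hzn
    refine mem_linkVertices.2 ⟨hz, fun h => ?_, fun u hu huz => ?_⟩
    · rcases (hmF z).1 h with ⟨-, h | h⟩
      · exact h.1 ((hP z y hzy).2 ((hP x y hxy).1 hxP))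
      · exact h.2 y hyW hzy
    · rcases (hmF u).1 hu with ⟨huW, h | h⟩
      · exact h.2 (hzn u huW huz.symm)
      · exact h.2 z hz huz
  have hmemY : ∀ v ∈ W, G.Adj x v → v ∈ linkVertices G W F := by
    intro v hv hxv
    refine mem_linkVertices.2 ⟨hv, fun h => ?_, fun u hu huv => ?_⟩
    · rcases (hmF v).1 h with ⟨-, h | h⟩
      · exact h.2 hxv
      · exact (hP x v hxv).1 hxP h.1
    · rcases (hmF u).1 hu with ⟨huW, h | h⟩
      · exact h.1 ((hP u v huv).2 ((hP x v hxv).1 hxP))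
      · exact h.2 v hv huv
  have hxL := hmem x hxW hxy fun _ _ h => h
  have hyL := hmemY y hyW hxy
  have hcard := hW F (Finset.filter_subset _ _) hFi
    ⟨⟨x, hxL, hxP⟩, ⟨y, hyL, (hP x y hxy).1 hxP⟩, fun a ha b hb haP hbP => by
      obtain ⟨haW, haF, haN⟩ := mem_linkVertices.1 ha
      obtain ⟨hbW, hbF, -⟩ := mem_linkVertices.1 hb
      have hxb : G.Adj x b := by
        by_contra h
        exact hbF ((hmF b).2 ⟨hbW, .inl ⟨hbP, h⟩⟩)
      have hsub : (W.filter fun w => G.Adj a w) ⊆ W.filter fun w => G.Adj x w := by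
        intro w hw
        obtain ⟨hwW, haw⟩ := Finset.mem_filter.1 hw
        refine Finset.mem_filter.2 ⟨hwW, ?_⟩
        by_contra h
        exact haN w ((hmF w).2 ⟨hwW, .inl ⟨(hP a w haw).1 haP, h⟩⟩) haw.symm
      have ha' : a ∈ W.filter fun v => P v ∧ ∃ w ∈ W, G.Adj v w := by
        refine Finset.mem_filter.2 ⟨haW, haP, ?_⟩
        by_contra! h
        exact haF ((hmF a).2 ⟨haW, .inr ⟨haP, h⟩⟩)
      have heq := Finset.eq_of_subset_of_card_le hsub (hmin a ha')
      exact (Finset.mem_filter.1 (heq ▸ Finset.mem_filter.2 ⟨hbW, hxb⟩)).2⟩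
  have hL : linkVertices G W F = {x, y} :=
    (Finset.eq_of_subset_of_card_le (Finset.insert_subset hxL (Finset.singleton_subset_iff.2 hyL))
      (by rwa [Finset.card_pair hxy.ne])).symm
  have hxn : ∀ v ∈ W, G.Adj x v → v = y := fun v hv hxv => by
    have := hmemY v hv hxv
    rw [hL, Finset.mem_insert, Finset.mem_singleton] at this
    exact this.resolve_left hxv.ne'
  refine ⟨x, hxW, y, hyW, hxP, hxy, hxn, fun z hz hzy hzn => ?_⟩
  have := hmem z hz hzy fun v hv h => hzn v hv h ▸ hxy
  rw [hL, Finset.mem_insert, Finset.mem_singleton] at this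
  exact this.resolve_right hzy.ne

open Classical in
lemma IsThin.erase {W : Finset V} (hW : IsThin G P W) {x y : V} (hx : x ∈ W) (hy : y ∈ W)
    (hxP : P x) (hxy : G.Adj x y) (hxn : ∀ v ∈ W, G.Adj x v → v = y) :
    IsThin G P (W.erase y) := by
  intro F hF hFi hc
  have hFW := hF.trans (Finset.erase_subset y W)
  have hyF : y ∉ F := fun h => Finset.notMem_erase y W (hF h)
  by_cases h : ∃ u ∈ F, G.Adj u y
  · obtain ⟨u, hu, huy⟩ := h
    have : linkVertices G (W.erase y) F = linkVertices G W F := by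
      ext v
      simp only [mem_linkVertices, Finset.mem_erase]
      refine ⟨fun h => ⟨h.1.2, h.2⟩, fun h => ⟨⟨?_, h.1⟩, h.2⟩⟩
      rintro rfl
      exact h.2.2 u hu huy
    rw [this] at hc ⊢
    exact hW F hFW hFi hc
  · push Not at h
    obtain ⟨-, ⟨b, hb, hbP⟩, hcomp⟩ := hc
    have hxL : x ∈ linkVertices G (W.erase y) F :=
      mem_linkVertices.2 ⟨Finset.mem_erase.2 ⟨hxy.ne, hx⟩, fun hxF => h x hxF hxy,
        fun u hu hux => hyF (hxn u (hFW hu) hux.symm ▸ hu)⟩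
    obtain ⟨hby, hbW⟩ := Finset.mem_erase.1 (mem_linkVertices.1 hb).1
    exact absurd (hxn b hbW (hcomp x hxL b hb hxP hbP)) hby

open Classical in
lemma IsThin.filter_not_adj {W : Finset V} (hW : IsThin G P W) {y : V} (hy : y ∈ W)
    (hyP : ¬ P y) : IsThin G P (W.filter fun v => ¬ G.Adj y v) := by
  intro F hF hFi hc
  by_cases hyF : y ∈ F
  · have : linkVertices G (W.filter fun v => ¬ G.Adj y v) F = linkVertices G W F := by
      ext v
      simp only [mem_linkVertices, Finset.mem_filter]
      exact ⟨fun h => ⟨h.1.1, h.2⟩, fun h => ⟨⟨h.1, h.2.2 y hyF⟩, h.2⟩⟩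
    rw [this] at hc ⊢
    exact hW F (hF.trans (Finset.filter_subset _ _)) hFi hc
  · obtain ⟨⟨a, ha, haP⟩, -, hcomp⟩ := hc
    have hyL : y ∈ linkVertices G (W.filter fun v => ¬ G.Adj y v) F :=
      mem_linkVertices.2 ⟨Finset.mem_filter.2 ⟨hy, G.loopless.irrefl y⟩, hyF,
        fun u hu huy => (Finset.mem_filter.1 (hF hu)).2 huy.symm⟩
    exact absurd (hcomp a ha y hyL haP hyP).symm
      (Finset.mem_filter.1 (mem_linkVertices.1 ha).1).2

open Classical in
lemma bipDim_erase (hP : ∀ u v, G.Adj u v → (P u ↔ ¬ P v)) {W : Finset V} {x y : V} (hx : x ∈ W)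
    (hy : y ∈ W) (hxP : P x) (hxy : G.Adj x y) (hxn : ∀ v ∈ W, G.Adj x v → v = y)
    (huniq : ∀ z ∈ W, G.Adj z y → (∀ v ∈ W, G.Adj z v → v = y) → z = x) :
    bipDim G P (W.erase y) = bipDim G P W := by
  have hyP : ¬ P y := (hP x y hxy).1 hxP
  have h : ((W.erase y).filter fun v => P v → ∀ w ∈ W.erase y, ¬ G.Adj v w) =
      insert x ((W.filter fun v => P v → ∀ w ∈ W, ¬ G.Adj v w).erase y) := by
    ext v
    simp only [Finset.mem_filter, Finset.mem_insert, Finset.mem_erase]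
    constructor
    · rintro ⟨⟨hvy, hvW⟩, hv⟩
      refine or_iff_not_imp_left.2 fun hvx => ⟨hvy, hvW, fun hvP w hw hvw => ?_⟩
      by_cases hwy : w = y
      · subst hwy
        refine hvx (huniq v hvW hvw fun u hu hvu => ?_)
        by_contra huw
        exact hv hvP u ⟨huw, hu⟩ hvu
      · exact hv hvP w ⟨hwy, hw⟩ hvw
    · rintro (rfl | ⟨hvy, hvW, hv⟩)
      · exact ⟨⟨hxy.ne, hx⟩, fun _ w hw hxw => hw.1 (hxn w hw.2 hxw)⟩
      · exact ⟨⟨hvy, hvW⟩, fun hvP w hw => hv hvP w hw.2⟩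
  rw [bipDim, bipDim, h, Finset.card_insert_of_notMem, Finset.card_erase_add_one]
  · exact Finset.mem_filter.2 ⟨hy, fun h => absurd h hyP⟩
  · intro h
    exact (Finset.mem_filter.1 (Finset.mem_erase.1 h).2).2 hxP y hy hxy

open Classical in
lemma bipDim_filter_not_adj (hP : ∀ u v, G.Adj u v → (P u ↔ ¬ P v)) {W : Finset V} {y : V}
    (hy : y ∈ W) (hyP : ¬ P y) :
    bipDim G P (W.filter fun v => ¬ G.Adj y v) = bipDim G P W := by
  unfold bipDim
  congr 1
  ext v
  simp only [Finset.mem_filter]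
  constructor
  · rintro ⟨⟨hvW, -⟩, hv⟩
    refine ⟨hvW, fun hvP w hw hvw => hv hvP w ⟨hw, fun hyw => ?_⟩ hvw⟩
    exact (hP v w hvw).1 hvP (not_not.1 fun h => hyP ((hP y w hyw).2 h))
  · rintro ⟨hvW, hv⟩
    exact ⟨⟨hvW, fun hyv => hv (not_not.1 fun h => hyP ((hP y v hyv).2 h)) y hy hyv.symm⟩,
      fun hvP w hw => hv hvP w hw.1⟩

open Classical in
lemma bipDim_eq_card {W : Finset V} (hW : IsIndepSet G W) : bipDim G P W = W.card :=
  congrArg Finset.card (Finset.filter_true_of_mem fun v hv _ w hw => hW v hv w hw)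

variable {k : Type} [Field k]

open Classical in
lemma IsThin.isZero_localCoh [Fintype V] (hP : ∀ u v, G.Adj u v → (P u ↔ ¬ P v)) (W : Finset V)
    (hW : IsThin G P W) :
    (∀ i < bipDim G P W, IsZero (localCoh (maxIdeal k V) i
      (MvPolynomial V k ⧸ offIdeal k (indLower G W)))) ∧
      ringKrullDim (MvPolynomial V k ⧸ offIdeal k (indLower G W)) ≤ bipDim G P W := by
  induction W using Finset.strongInduction with
  | H W ih =>
    by_cases hE : IsIndepSet G W
    · rw [indLower_eq_boxLower hE, bipDim_eq_card hE]
      exact ⟨fun i hi => isZero_localCoh_boxLower W 0 i hi, ringKrullDim_boxLower_le W⟩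
    · obtain ⟨x, hx, y, hy, hxP, hxy, hxn, huniq⟩ := hW.exists_pendant hP hE
      have hyP : ¬ P y := (hP x y hxy).1 hxP
      obtain ⟨hz₁, hd₁⟩ := ih _ (Finset.erase_ssubset hy) (hW.erase hx hy hxP hxy hxn)
      obtain ⟨hz₂, hd₂⟩ := ih _ (Finset.filter_ssubset.2 ⟨x, hx, not_not.2 hxy.symm⟩)
        (hW.filter_not_adj hy hyP)
      rw [bipDim_erase hP hx hy hxP hxy hxn huniq] at hz₁ hd₁
      rw [bipDim_filter_not_adj hP hy hyP] at hz₂ hd₂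
      obtain ⟨f, g, hfg, hf, hg⟩ := isSES_indLower (k := k) (G := G) hy
      refine ⟨fun i hi => hfg.isZero_middle _ (hz₂ i hi) (hz₁ i hi),
        ringKrullDim_quotient_le_of_forall_or (fun p hp hI => ?_) hd₁ hd₂⟩
      by_cases hyp : (monomial (Finsupp.single y 1) 1 : MvPolynomial V k) ∈ p
      · left
        intro r hr
        obtain ⟨s, hs⟩ := (hfg.exact (Ideal.Quotient.mk _ r)).1
          ((hg r).trans (Ideal.Quotient.eq_zero_iff_mem.2 hr))
        obtain ⟨s, rfl⟩ := Ideal.Quotient.mk_surjective s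
        rw [hf, Ideal.Quotient.eq] at hs
        have := p.sub_mem (p.mul_mem_right s hyp) (hI hs)
        rwa [sub_sub_cancel] at this
      · right
        intro r hr
        refine (hp.mem_or_mem (hI ?_)).resolve_left hyp
        rw [← Ideal.Quotient.eq_zero_iff_mem, ← hf, Ideal.Quotient.eq_zero_iff_mem.2 hr, map_zero]

end Bipartite

section Necessity

variable {V : Type} {G : SimpleGraph V} {P : V → Prop} {k : Type} [Field k]

lemma isSES_boxLower_sup [DecidableEq V] (A B : Finset V) :
    ∃ (f : (MvPolynomial V k ⧸ offIdeal k (boxLower A 0 ⊔ boxLower B 0)) →ₗ[MvPolynomial V k]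
        (MvPolynomial V k ⧸ offIdeal k (boxLower A 0)) ×
          (MvPolynomial V k ⧸ offIdeal k (boxLower B 0)))
      (g : (MvPolynomial V k ⧸ offIdeal k (boxLower A 0)) ×
          (MvPolynomial V k ⧸ offIdeal k (boxLower B 0)) →ₗ[MvPolynomial V k]
        (MvPolynomial V k ⧸ offIdeal k (boxLower (A ∩ B) 0))), IsSES f g :=
  isSES_mayerVietoris _ _ _ _ (offIdeal_sup _ _) (by rw [← boxLower_inf, offIdeal_inf])

lemma isZero_localCoh_boxLower_prod {A B : Finset V} {i : ℕ} (hA : i < A.card) (hB : i < B.card) :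
    IsZero (localCoh (maxIdeal k V) i ((MvPolynomial V k ⧸ offIdeal k (boxLower A 0)) ×
      (MvPolynomial V k ⧸ offIdeal k (boxLower B 0)))) :=
  isSES_prod.isZero_middle _ (isZero_localCoh_boxLower A 0 i hA) (isZero_localCoh_boxLower B 0 i hB)

lemma card_le_ringKrullDim_of_isIndepSet [Fintype V] {F : Finset V} (hF : IsIndepSet G F) :
    (F.card : WithBot ℕ∞) ≤
      ringKrullDim (MvPolynomial V k ⧸ offIdeal k (indLower G Finset.univ)) :=
  (le_ringKrullDim_boxLower F).trans <| ringKrullDim_quotient_le_of_le <| offIdeal_antitone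
    fun _ hd => mem_indLower.2 ⟨Finset.subset_univ _, hF.subset (mem_boxLower_zero.1 hd)⟩

lemma monomial_facePow_mem_maxIdeal {F : Finset V} (hF : F.Nonempty) :
    (monomial (facePow F 1) 1 : MvPolynomial V k) ∈ maxIdeal k V := by
  classical
  rw [← pow_one (maxIdeal k V), mem_maxIdeal_pow_iff]
  intro d hd
  obtain ⟨v, hv⟩ := hF
  rw [coeff_monomial, if_neg]
  rintro rfl
  rw [Nat.lt_one_iff, Finsupp.degree_eq_zero_iff] at hd
  simpa [facePow_apply, hv] using DFunLike.congr_fun hd v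

lemma HasNilpotentLC.ringKrullDim_le [Fintype V]
    (h : HasNilpotentLC (maxIdeal k V) (offIdeal k (indLower G Finset.univ))) {F : Finset V}
    (hF : F.Nonempty) (hFi : IsIndepSet G F) (hmax : ∀ v ∉ F, ∃ u ∈ F, G.Adj u v) :
    ringKrullDim (MvPolynomial V k ⧸ offIdeal k (indLower G Finset.univ)) ≤ F.card := by
  classical
  by_contra! hlt
  obtain ⟨N, hN⟩ := h _ hlt _ (monomial_facePow_mem_maxIdeal hF)
  refine not_lcKilledBy_boxLower F F 0 (N + 1) (fun v hv hv' => absurd hv hv')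
    (hN.star fun d => ?_)
  rw [mem_boxLower_zero, mem_indLower, support_facePow_add]
  refine ⟨fun hd => ⟨Finset.subset_univ _, ?_⟩, fun hd v hv => ?_⟩
  · rwa [Finset.union_eq_left.2 hd]
  · by_contra hvF
    obtain ⟨u, hu, huv⟩ := hmax v hvF
    exact hd.2 u (Finset.mem_union_left _ hu) v (Finset.mem_union_right _ hv) huv

open Classical in
lemma isIndepSet_union_filter (hP : ∀ u v, G.Adj u v → (P u ↔ ¬ P v)) {W F : Finset V}
    (hFi : IsIndepSet G F) (Q : V → Prop) [DecidablePred Q] (hQ : ∀ u v, Q u → Q v → (P u ↔ P v)) :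
    IsIndepSet G (F ∪ (linkVertices G W F).filter Q) := by
  intro u hu v hv huv
  rcases Finset.mem_union.1 hu with hu | hu <;> rcases Finset.mem_union.1 hv with hv | hv
  · exact hFi u hu v hv huv
  · exact (mem_linkVertices.1 (Finset.mem_filter.1 hv).1).2.2 u hu huv
  · exact (mem_linkVertices.1 (Finset.mem_filter.1 hu).1).2.2 v hv huv.symm
  · have h1 := hP u v huv
    have h2 := hQ u v (Finset.mem_filter.1 hu).2 (Finset.mem_filter.1 hv).2
    tauto

open Classical in
lemma HasNilpotentLC.card_linkVertices_le [Fintype V] (hP : ∀ u v, G.Adj u v → (P u ↔ ¬ P v))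
    (h : HasNilpotentLC (maxIdeal k V) (offIdeal k (indLower G Finset.univ))) {F : Finset V}
    (hF : F.Nonempty) (hFi : IsIndepSet G F)
    (hc : IsCompleteBipartiteOn G P (linkVertices G Finset.univ F)) :
    (linkVertices G Finset.univ F).card ≤ 2 := by
  by_contra! hcard
  set L := linkVertices G Finset.univ F with hL
  set A := F ∪ L.filter P with hA
  set B := F ∪ L.filter fun v => ¬ P v with hB
  have hdisj : ∀ (Q : V → Prop) [DecidablePred Q], Disjoint F (L.filter Q) := fun Q _ =>
    Finset.disjoint_left.2 fun v hv hv' =>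
      (mem_linkVertices.1 (Finset.mem_filter.1 hv').1).2.1 hv
  have hAi : IsIndepSet G A := isIndepSet_union_filter hP hFi P fun u v hu hv => iff_of_true hu hv
  have hBi : IsIndepSet G B :=
    isIndepSet_union_filter hP hFi (fun v => ¬ P v) fun u v hu hv => iff_of_false hu hv
  have hAc : A.card = F.card + (L.filter P).card := Finset.card_union_of_disjoint (hdisj _)
  have hBc : B.card = F.card + (L.filter fun v => ¬ P v).card :=
    Finset.card_union_of_disjoint (hdisj _)
  have hsum := Finset.card_filter_add_card_filter_not (s := L) P
  obtain ⟨⟨a, ha, haP⟩, ⟨b, hb, hbP⟩, hcomp⟩ := hc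
  have hA1 : 0 < (L.filter P).card := Finset.card_pos.2 ⟨a, Finset.mem_filter.2 ⟨ha, haP⟩⟩
  have hB1 : 0 < (L.filter fun v => ¬ P v).card :=
    Finset.card_pos.2 ⟨b, Finset.mem_filter.2 ⟨hb, hbP⟩⟩
  have hdim : ((F.card + 1 : ℕ) : WithBot ℕ∞) <
      ringKrullDim (MvPolynomial V k ⧸ offIdeal k (indLower G Finset.univ)) := by
    rcases le_or_gt 2 (L.filter P).card with h2 | h2
    · exact lt_of_lt_of_le (by rw [Nat.cast_lt]; omega) (card_le_ringKrullDim_of_isIndepSet hAi)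
    · exact lt_of_lt_of_le (by rw [Nat.cast_lt]; omega) (card_le_ringKrullDim_of_isIndepSet hBi)
  obtain ⟨N, hN⟩ := h _ hdim _ (monomial_facePow_mem_maxIdeal hF)
  obtain ⟨f, g, hfg⟩ := isSES_boxLower_sup (k := k) A B
  have hAB : A ∩ B = F := by
    ext v
    simp only [hA, hB, Finset.mem_inter, Finset.mem_union, Finset.mem_filter]
    tauto
  have hstar := hN.star (C := boxLower A 0 ⊔ boxLower B 0) fun d => by
    rw [LowerSet.mem_sup_iff, mem_boxLower_zero, mem_boxLower_zero, mem_indLower,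
      support_facePow_add]
    constructor
    · rintro (hd | hd)
      · exact ⟨Finset.subset_univ _,
          hAi.subset (Finset.union_subset Finset.subset_union_left hd)⟩
      · exact ⟨Finset.subset_univ _,
          hBi.subset (Finset.union_subset Finset.subset_union_left hd)⟩
    · rintro ⟨-, hd⟩
      have hmem : ∀ v ∈ d.support, v ∈ F ∨ v ∈ L := fun v hv => or_iff_not_imp_left.2 fun hvF =>
        mem_linkVertices.2 ⟨Finset.mem_univ v, hvF, fun u hu =>
          hd u (Finset.mem_union_left _ hu) v (Finset.mem_union_right _ hv)⟩
      by_contra! hsub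
      obtain ⟨h1, h2⟩ := hsub
      obtain ⟨u, hu, huA⟩ := Finset.not_subset.1 h1
      obtain ⟨v, hv, hvB⟩ := Finset.not_subset.1 h2
      simp only [hA, hB, Finset.mem_union, Finset.mem_filter, not_or, not_and, not_not] at huA hvB
      have huL := (hmem u hu).resolve_left huA.1
      have hvL := (hmem v hv).resolve_left hvB.1
      exact hd u (Finset.mem_union_right _ hu) v (Finset.mem_union_right _ hv)
        (hcomp v hvL u huL (hvB.2 hvL) (huA.2 huL)).symm
  have hker := hfg.killedBy_right _
    (isZero_localCoh_boxLower_prod (i := F.card) (by omega) (by omega)) hstar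
  rw [hAB] at hker
  exact not_lcKilledBy_boxLower F F 0 (N + 1) (fun v hv hv' => absurd hv hv') hker

/-- Nilpotent local cohomology forces the graph to be thin, or complete bipartite. -/
lemma HasNilpotentLC.isThin [Fintype V] (hP : ∀ u v, G.Adj u v → (P u ↔ ¬ P v))
    (h : HasNilpotentLC (maxIdeal k V) (offIdeal k (indLower G Finset.univ)))
    (hc : ¬ IsCompleteBipartiteOn G P Finset.univ) : IsThin G P Finset.univ := by
  intro F _ hFi hF
  refine h.card_linkVertices_le hP (Finset.nonempty_iff_ne_empty.2 ?_) hFi hF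
  rintro rfl
  refine hc (?_ : IsCompleteBipartiteOn G P _)
  convert hF
  ext v
  simp [mem_linkVertices]

end Necessity

section CompleteBipartite

variable {V : Type} {G : SimpleGraph V} {P : V → Prop} {k : Type} [Field k]

open Classical in
lemma IsCompleteBipartiteOn.card_eq [Fintype V] (hP : ∀ u v, G.Adj u v → (P u ↔ ¬ P v))
    (hc : IsCompleteBipartiteOn G P Finset.univ)
    (h : HasNilpotentLC (maxIdeal k V) (offIdeal k (indLower G Finset.univ))) :
    (Finset.univ.filter P).card = (Finset.univ.filter fun v => ¬ P v).card := by
  obtain ⟨⟨a, -, ha⟩, ⟨b, -, hb⟩, hcomp⟩ := hc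
  have hX : IsIndepSet G (Finset.univ.filter P) := fun u hu v hv huv => by
    simpa [(Finset.mem_filter.1 hu).2, (Finset.mem_filter.1 hv).2] using hP u v huv
  have hY : IsIndepSet G (Finset.univ.filter fun v => ¬ P v) := fun u hu v hv huv => by
    simpa [(Finset.mem_filter.1 hu).2, (Finset.mem_filter.1 hv).2] using hP u v huv
  have h1 := h.ringKrullDim_le (F := Finset.univ.filter P) ⟨a, by simpa using ha⟩ hX fun v hv =>
    ⟨a, by simpa using ha, hcomp a (Finset.mem_univ _) v (Finset.mem_univ _) ha (by simpa using hv)⟩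
  have h2 := h.ringKrullDim_le (F := Finset.univ.filter fun v => ¬ P v) ⟨b, by simpa using hb⟩ hY
    fun v hv => ⟨b, by simpa using hb,
      (hcomp v (Finset.mem_univ _) b (Finset.mem_univ _) (by simpa using hv) hb).symm⟩
  have h3 := (card_le_ringKrullDim_of_isIndepSet (k := k) hX).trans h2
  have h4 := (card_le_ringKrullDim_of_isIndepSet (k := k) hY).trans h1
  rw [Nat.cast_le] at h3 h4
  exact le_antisymm h3 h4

open Classical in
lemma IsCompleteBipartiteOn.indLower_univ [Fintype V] (hP : ∀ u v, G.Adj u v → (P u ↔ ¬ P v))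
    (hc : IsCompleteBipartiteOn G P Finset.univ) :
    indLower G Finset.univ =
      boxLower (Finset.univ.filter P) 0 ⊔ boxLower (Finset.univ.filter fun v => ¬ P v) 0 := by
  ext d
  refine mem_indLower.trans (Iff.trans ?_
    ((LowerSet.mem_sup_iff).trans (or_congr mem_boxLower_zero mem_boxLower_zero)).symm)
  constructor
  · rintro ⟨-, hd⟩
    by_contra! h
    obtain ⟨h1, h2⟩ := h
    obtain ⟨u, hu, huA⟩ := Finset.not_subset.1 h1
    obtain ⟨v, hv, hvB⟩ := Finset.not_subset.1 h2
    exact hd u hu v hv (hc.2.2 v (Finset.mem_univ _) u (Finset.mem_univ _) (by simpa using hvB)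
      (by simpa using huA)).symm
  · rintro (hd | hd)
    · refine ⟨Finset.subset_univ _, fun u hu v hv huv => ?_⟩
      simpa [(Finset.mem_filter.1 (hd hu)).2, (Finset.mem_filter.1 (hd hv)).2] using hP u v huv
    · refine ⟨Finset.subset_univ _, fun u hu v hv huv => ?_⟩
      simpa [(Finset.mem_filter.1 (hd hu)).2, (Finset.mem_filter.1 (hd hv)).2] using hP u v huv

lemma ringKrullDim_boxLower_sup_le {A B : Finset V} {n : ℕ} (hA : A.card = n) (hB : B.card = n) :
    ringKrullDim (MvPolynomial V k ⧸ offIdeal k (boxLower A 0 ⊔ boxLower B 0)) ≤ n := by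
  refine ringKrullDim_quotient_le_of_forall_or (fun p hp h => ?_)
    (hA ▸ ringKrullDim_boxLower_le A) (hB ▸ ringKrullDim_boxLower_le B)
  rw [offIdeal_sup] at h
  exact hp.inf_le.1 h

lemma isZero_localCoh_boxLower_sup [Finite V] [DecidableEq V] {A B : Finset V} {n i : ℕ}
    (hA : A.card = n) (hB : B.card = n) (hAB : A ∩ B = ∅) (hi : i < n) (hi1 : i ≠ 1) :
    IsZero (localCoh (maxIdeal k V) i
      (MvPolynomial V k ⧸ offIdeal k (boxLower A 0 ⊔ boxLower B 0))) := by
  have hS := isSES_boxLower_sup (k := k) A B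
  rw [hAB, offIdeal_boxLower_empty] at hS
  obtain ⟨f, g, hfg⟩ := hS
  have hprod := isZero_localCoh_boxLower_prod (k := k) (hA.symm ▸ hi) (hB.symm ▸ hi)
  match i with
  | 0 => exact hfg.isZero_left_zero _ hprod
  | 1 => exact absurd rfl hi1
  | i + 2 => exact hfg.isZero_left _ hprod (isZero_localCoh_succ_maxIdeal i)

lemma isBuchsbaumIdeal_and_isGCMIdeal_boxLower_sup [Finite V] [DecidableEq V] {A B : Finset V}
    (hcard : A.card = B.card) (hAB : A ∩ B = ∅) :
    IsBuchsbaumIdeal (maxIdeal k V) (offIdeal k (boxLower A 0 ⊔ boxLower B 0)) ∧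
      IsGCMIdeal (maxIdeal k V) (offIdeal k (boxLower A 0 ⊔ boxLower B 0)) := by
  have key : ∀ i : ℕ, (i : WithBot ℕ∞) < ringKrullDim
      (MvPolynomial V k ⧸ offIdeal k (boxLower A 0 ⊔ boxLower B 0)) → i < A.card := fun i hi =>
    Nat.cast_lt.1 (hi.trans_le (ringKrullDim_boxLower_sup_le rfl hcard.symm))
  have hS := isSES_boxLower_sup (k := k) A B
  rw [hAB, offIdeal_boxLower_empty] at hS
  obtain ⟨f, g, hfg⟩ := hS
  refine ⟨fun i hi => ?_, fun i hi => ?_⟩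
  · by_cases h1 : i = 1
    · subst h1
      exact hfg.stageOne_left _
        (isZero_localCoh_boxLower_prod (key _ hi) (hcard ▸ key _ hi)) (stageOne_zero_quotient _)
    · exact stageOne_of_isZero _
        (isZero_localCoh_boxLower_sup rfl hcard.symm hAB (key i hi) h1)
  · by_cases h1 : i = 1
    · subst h1
      exact hfg.isFiniteLength_left _
        (isZero_localCoh_boxLower_prod (key _ hi) (hcard ▸ key _ hi))
        (isFiniteLength_zero_quotient _)
    · exact isFiniteLength_of_isZero _
        (isZero_localCoh_boxLower_sup rfl hcard.symm hAB (key i hi) h1)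

lemma IsCMIdeal.isBuchsbaumIdeal {R : Type} [CommRing R] {J I : Ideal R} (h : IsCMIdeal J I) :
    IsBuchsbaumIdeal J I := fun i hi => stageOne_of_isZero J (h i hi)

lemma IsCMIdeal.isGCMIdeal {R : Type} [CommRing R] {J I : Ideal R} (h : IsCMIdeal J I) :
    IsGCMIdeal J I := fun i hi => isFiniteLength_of_isZero J (h i hi)

open Classical in
lemma IsThin.isCMIdeal [Fintype V] (hP : ∀ u v, G.Adj u v → (P u ↔ ¬ P v))
    (h : IsThin G P Finset.univ) :
    IsCMIdeal (maxIdeal k V) (offIdeal k (indLower G Finset.univ)) := fun i hi =>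
  (h.isZero_localCoh hP _).1 i (Nat.cast_lt.1 (hi.trans_le (h.isZero_localCoh hP _).2))

end CompleteBipartite

section SkewFerrers

variable {n : ℕ} {lam mu : ℕ → ℕ}

lemma skewGraph_adj_inl_inr {i : Fin n} {j : Fin (lam 0)} :
    (skewGraph n lam mu).Adj (Sum.inl i) (Sum.inr j) ↔ mu i ≤ j ∧ (j : ℕ) < lam i := by
  simp [skewGraph, SimpleGraph.fromRel_adj]

lemma skewGraph_adj_bipartite (u v : Fin n ⊕ Fin (lam 0)) (h : (skewGraph n lam mu).Adj u v) :
    (u.isLeft = true ↔ ¬ v.isLeft = true) := by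
  rcases u with i | j <;> rcases v with i' | j' <;>
    simp [skewGraph, SimpleGraph.fromRel_adj] at h ⊢

lemma not_isIndepSet_iff {T : Finset (Fin n ⊕ Fin (lam 0))} :
    ¬ IsIndepSet (skewGraph n lam mu) T ↔ ∃ (i : Fin n) (j : Fin (lam 0)),
      mu i ≤ j ∧ (j : ℕ) < lam i ∧ Sum.inl i ∈ T ∧ Sum.inr j ∈ T := by
  constructor
  · intro h
    simp only [IsIndepSet, not_forall, not_not] at h
    obtain ⟨u, hu, v, hv, huv⟩ := h
    rcases u with i | j <;> rcases v with i' | j'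
    · simpa using skewGraph_adj_bipartite _ _ huv
    · obtain ⟨h1, h2⟩ := skewGraph_adj_inl_inr.1 huv
      exact ⟨i, j', h1, h2, hu, hv⟩
    · obtain ⟨h1, h2⟩ := skewGraph_adj_inl_inr.1 huv.symm
      exact ⟨i', j, h1, h2, hv, hu⟩
    · simpa using skewGraph_adj_bipartite _ _ huv
  · rintro ⟨i, j, h1, h2, hi, hj⟩ h
    exact h _ hi _ hj (skewGraph_adj_inl_inr.2 ⟨h1, h2⟩)

lemma skewIdeal_eq_offIdeal (k : Type) [Field k] :
    skewIdeal k n lam mu = offIdeal k (indLower (skewGraph n lam mu) Finset.univ) := by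
  classical
  have hmon : ∀ (i : Fin n) (j : Fin (lam 0)),
      (X (Sum.inl i) * X (Sum.inr j) : MvPolynomial (Fin n ⊕ Fin (lam 0)) k) =
        monomial (Finsupp.single (Sum.inl i) 1 + Finsupp.single (Sum.inr j) 1) 1 := fun i j => by
    rw [X, X, monomial_mul, one_mul]
  refine le_antisymm (Ideal.span_le.2 ?_) fun f hf => ?_
  · rintro _ ⟨i, j, h1, h2, rfl⟩ d hd
    rw [hmon, coeff_monomial, if_neg]
    rintro rfl
    exact not_isIndepSet_iff.2 ⟨i, j, h1, h2, by simp, by simp⟩ (mem_indLower.1 hd).2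
  · rw [f.as_sum]
    refine Ideal.sum_mem _ fun d hd => ?_
    have hnd : ¬ IsIndepSet (skewGraph n lam mu) d.support := fun h =>
      mem_support_iff.1 hd (hf d (mem_indLower.2 ⟨Finset.subset_univ _, h⟩))
    obtain ⟨i, j, h1, h2, hi, hj⟩ := not_isIndepSet_iff.1 hnd
    have hle : Finsupp.single (Sum.inl i) 1 + Finsupp.single (Sum.inr j) 1 ≤ d := fun v => by
      rw [Finsupp.mem_support_iff] at hi hj
      rcases v with v | v
      · by_cases h : i = v
        · subst h
          simpa using Nat.one_le_iff_ne_zero.2 hi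
        · simp [h]
      · by_cases h : j = v
        · subst h
          simpa using Nat.one_le_iff_ne_zero.2 hj
        · simp [h]
    have : monomial d (coeff d f) = X (Sum.inl i) * X (Sum.inr j) *
        monomial (d - (Finsupp.single (Sum.inl i) 1 + Finsupp.single (Sum.inr j) 1))
          (coeff d f) := by
      rw [hmon, monomial_mul, one_mul, add_tsub_cancel_of_le hle]
    rw [this]
    exact Ideal.mul_mem_right _ _ (Ideal.subset_span ⟨i, j, h1, h2, rfl⟩)

lemma IsSkewShape.isCompleteBipartiteOn_iff (h : IsSkewShape n lam mu) :
    IsCompleteBipartiteOn (skewGraph n lam mu) (fun v => v.isLeft = true) Finset.univ ↔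
      (∀ i < n, lam i = lam 0) ∧ ∀ i, mu i = 0 := by
  obtain ⟨hn, hlam, hmu, hlt, -, -⟩ := h
  have h0 : 0 < lam 0 := (Nat.zero_le _).trans_lt (hlt 0 hn)
  constructor
  · rintro ⟨-, -, hc⟩
    have hadj : ∀ (i : Fin n) (j : Fin (lam 0)), mu i ≤ j ∧ (j : ℕ) < lam i := fun i j =>
      skewGraph_adj_inl_inr.1 (hc _ (Finset.mem_univ _) _ (Finset.mem_univ _) rfl (by simp))
    refine ⟨fun i hi => le_antisymm (hlam (Nat.zero_le i)) ?_, fun i => ?_⟩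
    · have := (hadj ⟨i, hi⟩ ⟨lam 0 - 1, by omega⟩).2
      simp only at this
      omega
    · exact Nat.le_zero.1 ((hmu (Nat.zero_le i)).trans (hadj ⟨0, hn⟩ ⟨0, h0⟩).1)
  · rintro ⟨h1, h2⟩
    refine ⟨⟨Sum.inl ⟨0, hn⟩, Finset.mem_univ _, rfl⟩,
      ⟨Sum.inr ⟨0, h0⟩, Finset.mem_univ _, by simp⟩,
      fun a _ b _ ha hb => ?_⟩
    rcases a with i | j
    · rcases b with i' | j'
      · exact absurd rfl hb
      · exact skewGraph_adj_inl_inr.2 ⟨(h2 i).le.trans (Nat.zero_le _), (h1 i i.2).symm ▸ j'.2⟩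
    · simp at ha

lemma card_filter_isLeft (a b : ℕ) :
    (Finset.univ.filter fun v : Fin a ⊕ Fin b => v.isLeft = true).card = a := by
  rw [← Fintype.card_subtype, Fintype.card_congr (Equiv.sumIsLeft), Fintype.card_fin]

lemma card_filter_not_isLeft (a b : ℕ) :
    (Finset.univ.filter fun v : Fin a ⊕ Fin b => ¬ v.isLeft = true).card = b := by
  have := Finset.card_filter_add_card_filter_not (s := Finset.univ)
    fun v : Fin a ⊕ Fin b => v.isLeft = true
  rw [card_filter_isLeft, Finset.card_univ, Fintype.card_sum, Fintype.card_fin,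
    Fintype.card_fin] at this
  omega

lemma HasNilpotentLC.isCMIdeal_or {k : Type} [Field k] (hs : IsSkewShape n lam mu)
    (h : HasNilpotentLC (maxIdeal k (Fin n ⊕ Fin (lam 0))) (skewIdeal k n lam mu)) :
    IsCMIdeal (maxIdeal k (Fin n ⊕ Fin (lam 0))) (skewIdeal k n lam mu) ∨
      ((∀ i, i < n → lam i = n) ∧ ∀ i, mu i = 0) := by
  rw [skewIdeal_eq_offIdeal] at h ⊢
  by_cases hc : IsCompleteBipartiteOn (skewGraph n lam mu) (fun v => v.isLeft = true) Finset.univ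
  · right
    have hcard := hc.card_eq skewGraph_adj_bipartite h
    have hcard' : n = lam 0 := by
      convert hcard
      · convert (card_filter_isLeft n (lam 0)).symm
      · convert (card_filter_not_isLeft n (lam 0)).symm
    obtain ⟨h1, h2⟩ := hs.isCompleteBipartiteOn_iff.1 hc
    exact ⟨fun i hi => (h1 i hi).trans hcard'.symm, h2⟩
  · exact .inl ((h.isThin skewGraph_adj_bipartite hc).isCMIdeal skewGraph_adj_bipartite)

open Classical in
lemma isBuchsbaumIdeal_and_isGCMIdeal_of_square {k : Type} [Field k] (hs : IsSkewShape n lam mu)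
    (h : (∀ i, i < n → lam i = n) ∧ ∀ i, mu i = 0) :
    IsBuchsbaumIdeal (maxIdeal k (Fin n ⊕ Fin (lam 0))) (skewIdeal k n lam mu) ∧
      IsGCMIdeal (maxIdeal k (Fin n ⊕ Fin (lam 0))) (skewIdeal k n lam mu) := by
  have h0 : lam 0 = n := h.1 0 hs.1
  have hc := hs.isCompleteBipartiteOn_iff.2 ⟨fun i hi => (h.1 i hi).trans h0.symm, h.2⟩
  rw [skewIdeal_eq_offIdeal, hc.indLower_univ skewGraph_adj_bipartite]
  refine isBuchsbaumIdeal_and_isGCMIdeal_boxLower_sup ?_ ?_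
  · convert h0.symm
    · convert card_filter_isLeft n (lam 0)
    · convert card_filter_not_isLeft n (lam 0)
  · ext v
    simp

end SkewFerrers

/-- For a skew shape `λ/μ` with `G_{λ/μ}` connected, the following are
equivalent: (1) `I_{λ/μ}` is Buchsbaum; (2) `I_{λ/μ}` is generalized Cohen-Macaulay;
(3) either `I_{λ/μ}` is Cohen-Macaulay, or `λ = (n,…,n)` (`n` repeated `n` times) and
`μ = (0,…,0)`. -/
theorem stmt_15 (k : Type) [Field k] (n : ℕ) (lam mu : ℕ → ℕ)
    (hshape : IsSkewShape n lam mu)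
    (hconn : (skewGraph n lam mu).Connected) :
    (IsBuchsbaumIdeal (maxIdeal k (Fin n ⊕ Fin (lam 0))) (skewIdeal k n lam mu) ↔
      IsGCMIdeal (maxIdeal k (Fin n ⊕ Fin (lam 0))) (skewIdeal k n lam mu)) ∧
    (IsGCMIdeal (maxIdeal k (Fin n ⊕ Fin (lam 0))) (skewIdeal k n lam mu) ↔
      (IsCMIdeal (maxIdeal k (Fin n ⊕ Fin (lam 0))) (skewIdeal k n lam mu) ∨
        ((∀ i, i < n → lam i = n) ∧ ∀ i, mu i = 0))) := by
  have hB := fun h : _ ∨ _ => h.elim (IsCMIdeal.isBuchsbaumIdeal (I := skewIdeal k n lam mu))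
    fun h' => (isBuchsbaumIdeal_and_isGCMIdeal_of_square hshape h').1
  have hG := fun h : _ ∨ _ => h.elim (IsCMIdeal.isGCMIdeal (I := skewIdeal k n lam mu))
    fun h' => (isBuchsbaumIdeal_and_isGCMIdeal_of_square hshape h').2
  exact ⟨⟨fun h => hG ((h.hasNilpotentLC _).isCMIdeal_or hshape),
    fun h => hB ((h.hasNilpotentLC _).isCMIdeal_or hshape)⟩,
    fun h => (h.hasNilpotentLC _).isCMIdeal_or hshape, hG⟩

end SkewTab
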